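/- arXiv:1108.2207 — 9 statements merged into one kernel-verified Lean document; each statement's English description precedes it below -/
import Mathlib

section
/- Let A be a commutative ring equipped with a Poisson bracket B, and let S be a submonoid (multiplicative subset) of A. Then the localization S⁻¹A carries a Poisson bracket B' such that the canonical ring homomorphism ι : A → S⁻¹A is a homomorphism of Poisson algebras, i.e. B'(ι f)(ι g) = ι(B f g) for all f, g ∈ A. -/
/-- A Poisson bracket on a commutative ring `A`: a map `B : A → A → A`, additive in each
argument, antisymmetric, satisfying the Jacobi identity and the Leibniz rule. -/
def IsPoissonBracket {A : Type*} [CommRing A] (B : A → A → A) : Prop :=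
  (∀ f g h : A, B (f + g) h = B f h + B g h) ∧
  (∀ f g h : A, B f (g + h) = B f g + B f h) ∧
  (∀ f g : A, B f g = - B g f) ∧
  (∀ f g h : A, B f (B g h) + B g (B h f) + B h (B f g) = 0) ∧
  (∀ f g h : A, B (f * g) h = f * B g h + g * B f h)

/-- A map on a localization satisfying the Leibniz rule vanishes if it vanishes on the image of
the base ring. -/
theorem IsLocalization.leibniz_eq_zero {A L : Type*} [CommRing A] [CommRing L] [Algebra A L]
    (S : Submonoid A) [IsLocalization S L] (F : L → L)
    (hmul : ∀ x y, F (x * y) = x * F y + y * F x)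
    (h : ∀ a : A, F (algebraMap A L a) = 0) (x : L) : F x = 0 := by
  obtain ⟨⟨a, s⟩, hx⟩ := IsLocalization.surj S x
  have key := hmul x (algebraMap A L s)
  rw [hx, h, h, mul_zero, zero_add] at key
  exact (IsLocalization.map_units L s).mul_right_eq_zero.mp key.symm

/-- Two maps on a localization satisfying the Leibniz rule agree if they agree on the image of
the base ring. -/
theorem IsLocalization.leibniz_ext {A L : Type*} [CommRing A] [CommRing L] [Algebra A L]
    (S : Submonoid A) [IsLocalization S L] (F G : L → L)
    (hF : ∀ x y, F (x * y) = x * F y + y * F x)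
    (hG : ∀ x y, G (x * y) = x * G y + y * G x)
    (h : ∀ a : A, F (algebraMap A L a) = G (algebraMap A L a)) (x : L) : F x = G x :=
  sub_eq_zero.mp <| IsLocalization.leibniz_eq_zero S (fun x => F x - G x)
    (fun x y => by simp only [hF, hG]; ring) (fun a => sub_eq_zero.mpr (h a)) x

/-- A derivation from a ring to its localization extends to the localization. -/
theorem IsLocalization.exists_leibniz_extension {A L : Type*} [CommRing A] [CommRing L]
    [Algebra A L] (S : Submonoid A) [IsLocalization S L] (d : A → L)
    (hadd : ∀ a b, d (a + b) = d a + d b)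
    (hmul : ∀ a b, d (a * b) = algebraMap A L a * d b + algebraMap A L b * d a) :
    ∃ D : L → L, (∀ x y, D (x + y) = D x + D y) ∧ (∀ x y, D (x * y) = x * D y + y * D x) ∧
      ∀ a, D (algebraMap A L a) = d a := by
  have d_zero : d 0 = 0 := by simpa using hadd 0 0
  have d_one : d 1 = 0 := by simpa using hmul 1 1
  let φ : A →+* TrivSqZeroExt L L :=
    { toFun := fun a => TrivSqZeroExt.inl (algebraMap A L a) + TrivSqZeroExt.inr (d a)
      map_one' := by ext <;> simp [d_one]
      map_zero' := by ext <;> simp [d_zero]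
      map_add' := fun a b => by ext <;> simp [hadd]
      map_mul' := fun a b => by ext <;> simp [hmul, mul_comm] }
  have φ_fst : ∀ a, (φ a).fst = algebraMap A L a := fun a => by simp [φ]
  have φ_snd : ∀ a, (φ a).snd = d a := fun a => by simp [φ]
  have hφ : ∀ s : S, IsUnit (φ s) := fun s =>
    TrivSqZeroExt.isUnit_iff_isUnit_fst.mpr (φ_fst s ▸ IsLocalization.map_units L s)
  let ψ : L →+* TrivSqZeroExt L L := IsLocalization.lift hφ
  have hψ : ∀ a, ψ (algebraMap A L a) = φ a := fun a => IsLocalization.lift_eq hφ a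
  have hfst : ∀ x, (ψ x).fst = x := fun x =>
    RingHom.congr_fun (IsLocalization.ringHom_ext S
      (j := (TrivSqZeroExt.fstHom L L L).toRingHom.comp ψ) (k := RingHom.id L)
      (RingHom.ext fun a => (congrArg TrivSqZeroExt.fst (hψ a)).trans (φ_fst a))) x
  refine ⟨fun x => (ψ x).snd, fun x y => ?_, fun x y => ?_, fun a => ?_⟩
  · simp
  · simp only [map_mul, TrivSqZeroExt.snd_mul, hfst, op_smul_eq_smul, smul_eq_mul]
  · exact (congrArg TrivSqZeroExt.snd (hψ a)).trans (φ_snd a)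

/-- The localization `S⁻¹A` of a Poisson algebra `A` at a multiplicative subset `S` carries a
Poisson bracket making the canonical map `A → S⁻¹A` a homomorphism of Poisson algebras. -/
theorem localization_poisson_bracket {A : Type*} [CommRing A] (B : A → A → A)
    (hB : IsPoissonBracket B) (S : Submonoid A) :
    ∃ B' : Localization S → Localization S → Localization S,
      IsPoissonBracket B' ∧
      ∀ f g : A,
        B' (algebraMap A (Localization S) f) (algebraMap A (Localization S) g) =
          algebraMap A (Localization S) (B f g) := by
  obtain ⟨add_left, add_right, antisymm, jacobi, leibniz⟩ := hB
  have leibniz_right : ∀ f g h, B f (g * h) = g * B f h + h * B f g := fun f g h => by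
    rw [antisymm f (g * h), leibniz, antisymm f h, antisymm f g]; ring
  choose D D_add D_mul D_map using fun g : A =>
    IsLocalization.exists_leibniz_extension (L := Localization S) S
      (fun f => algebraMap A _ (B f g))
      (fun a b => by rw [add_left, map_add])
      (fun a b => by rw [leibniz, map_add, map_mul, map_mul])
  have D_add_index : ∀ x a b, D (a + b) x = D a x + D b x := fun x a b =>
    IsLocalization.leibniz_ext S _ (fun x => D a x + D b x) (D_mul _)
      (fun x y => by simp only [D_mul]; ring)
      (fun f => by simp only [D_map, add_right, map_add]) x
  have D_mul_index : ∀ x a b, D (a * b) x =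
      algebraMap A _ a * D b x + algebraMap A _ b * D a x := fun x a b =>
    IsLocalization.leibniz_ext S _ (fun x => algebraMap A _ a * D b x + algebraMap A _ b * D a x)
      (D_mul _)
      (fun x y => by simp only [D_mul]; ring)
      (fun f => by simp only [D_map, leibniz_right, map_add, map_mul]) x
  choose E E_add E_mul E_map using fun x : Localization S =>
    IsLocalization.exists_leibniz_extension S (fun g => D g x) (D_add_index x) (D_mul_index x)
  have E_map_map : ∀ f g, E (algebraMap A _ f) (algebraMap A _ g) =
      algebraMap A _ (B f g) := fun f g => by rw [E_map, D_map]
  have E_add_left : ∀ x y z, E (x + y) z = E x z + E y z := fun x y z =>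
    IsLocalization.leibniz_ext S _ (fun z => E x z + E y z) (E_mul _)
      (fun z w => by simp only [E_mul]; ring)
      (fun g => by simp only [E_map, D_add]) z
  have E_mul_left : ∀ x y z, E (x * y) z = x * E y z + y * E x z := fun x y z =>
    IsLocalization.leibniz_ext S _ (fun z => x * E y z + y * E x z) (E_mul _)
      (fun z w => by simp only [E_mul]; ring)
      (fun g => by simp only [E_map, D_mul]) z
  have E_antisymm : ∀ x y, E x y = -E y x := fun x y =>
    IsLocalization.leibniz_ext S _ (fun y => -E y x) (E_mul x)
      (fun y z => by simp only [E_mul_left]; ring)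
      (fun g => IsLocalization.leibniz_ext S (fun x => E x (algebraMap A _ g))
        (fun x => -E (algebraMap A _ g) x)
        (fun x y => E_mul_left x y _) (fun x y => by simp only [E_mul]; ring)
        (fun f => by simp only [E_map_map]; rw [antisymm, map_neg]) x) y
  -- The Jacobiator obeys the Leibniz rule in its first argument, and it is cyclically invariant.
  let J : Localization S → Localization S → Localization S → Localization S :=
    fun x y z => E x (E y z) + E y (E z x) + E z (E x y)
  have J_cyclic : ∀ x y z, J x y z = J y z x := fun x y z => by simp only [J]; ring
  have J_mul : ∀ y z x w, J (x * w) y z = x * J w y z + w * J x y z := fun y z x w => by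
    simp only [J, E_mul_left, E_mul, E_add]
    rw [E_antisymm x y, E_antisymm w y]
    ring
  have J_map : ∀ f g h, J (algebraMap A _ f) (algebraMap A _ g) (algebraMap A _ h) = 0 :=
    fun f g h => by simp only [J, E_map_map, ← map_add, jacobi, map_zero]
  have J_zero : ∀ x y z, J x y z = 0 := fun x y z =>
    IsLocalization.leibniz_eq_zero S (fun x => J x y z) (J_mul y z) (fun f => by
      rw [J_cyclic]
      refine IsLocalization.leibniz_eq_zero S (fun y => J y z _) (J_mul z _) (fun g => ?_) y
      rw [J_cyclic]
      exact IsLocalization.leibniz_eq_zero S (fun z => J z _ _) (J_mul _ _)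
        (fun h => J_map h f g) z) x
  exact ⟨E, ⟨E_add_left, E_add, E_antisymm, J_zero, E_mul_left⟩, E_map_map⟩
end

section
/- Let A be a commutative ring with a Poisson bracket B and let I be a Poisson ideal of A. Then: (i) B f g ∈ I² whenever f ∈ I² and g ∈ I; (ii) for all a ∈ A and f, g ∈ I, one has B (a·f) g − a·(B f g) ∈ I². Consequently B induces a well-defined bracket on the (A⧸I)-module I⧸I², given by [f mod I², g mod I²] := (B f g) mod I², and this bracket is (A⧸I)-bilinear, antisymmetric, and satisfies the Jacobi identity (it is the linearization of the Poisson bracket along I, the Lie bracket of the cotangent Lie algebroid). -/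
namespace IsPoissonBracket

variable {A : Type*} [CommRing A] {B : A → A → A} {I : Ideal A}

theorem sub_left (hB : IsPoissonBracket B) (f g h : A) : B (f - g) h = B f h - B g h := by
  rw [eq_sub_iff_add_eq, ← hB.1, sub_add_cancel]

theorem mul_sub_mem_sq (hB : IsPoissonBracket B) (hI : ∀ f g : A, g ∈ I → B f g ∈ I)
    (a : A) {f g : A} (hf : f ∈ I) (hg : g ∈ I) : B (a * f) g - a * B f g ∈ I ^ 2 := by
  rw [hB.2.2.2.2, add_sub_cancel_left, sq]
  exact Ideal.mul_mem_mul hf (hI a g hg)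

theorem mem_sq_of_left_mem_sq (hB : IsPoissonBracket B) (hI : ∀ f g : A, g ∈ I → B f g ∈ I)
    {f g : A} (hf : f ∈ I ^ 2) (hg : g ∈ I) : B f g ∈ I ^ 2 := by
  rw [sq] at hf ⊢
  induction hf using Submodule.mul_induction_on' with
  | mem_mul_mem a ha b hb =>
    rw [hB.2.2.2.2]
    exact add_mem (Ideal.mul_mem_mul ha (hI b g hg)) (Ideal.mul_mem_mul hb (hI a g hg))
  | add x _ y _ hx hy =>
    rw [hB.1]
    exact add_mem hx hy

/-- The bracket of two elements of `I` modulo `I²` depends only on their classes modulo `I²`. -/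
theorem sub_mem_sq (hB : IsPoissonBracket B) (hI : ∀ f g : A, g ∈ I → B f g ∈ I)
    {f f' g g' : A} (hf : f ∈ I) (hg' : g' ∈ I) (hff' : f - f' ∈ I ^ 2) (hgg' : g - g' ∈ I ^ 2) :
    B f g - B f' g' ∈ I ^ 2 := by
  have h : B f g - B f' g' = B (f - f') g' - B (g - g') f := by
    rw [hB.sub_left, hB.sub_left, hB.2.2.1 g f, hB.2.2.1 g' f]
    ring
  rw [h]
  exact sub_mem (hB.mem_sq_of_left_mem_sq hI hff' hg') (hB.mem_sq_of_left_mem_sq hI hgg' hf)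

end IsPoissonBracket

/-- Linearization of a Poisson bracket along a Poisson ideal `I`: (i) `B f g ∈ I²` for
`f ∈ I², g ∈ I`; (ii) `B (a·f) g − a·(B f g) ∈ I²` for `a ∈ A`, `f, g ∈ I`; consequently `B`
induces a well-defined `(A⧸I)`-bilinear, antisymmetric bracket on `I⧸I²` (here `I.Cotangent`)
satisfying the Jacobi identity. -/
theorem linearization_poisson_bracket {A : Type*} [CommRing A] (B : A → A → A)
    (hB : IsPoissonBracket B) (I : Ideal A) (hI : ∀ f g : A, g ∈ I → B f g ∈ I) :
    (∀ f g : A, f ∈ I ^ 2 → g ∈ I → B f g ∈ I ^ 2) ∧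
    (∀ (a f g : A), f ∈ I → g ∈ I → B (a * f) g - a * B f g ∈ I ^ 2) ∧
    ∃ br : I.Cotangent → I.Cotangent → I.Cotangent,
      (∀ f g : I,
        br (I.toCotangent f) (I.toCotangent g) =
          I.toCotangent ⟨B (f : A) (g : A), hI (f : A) (g : A) g.2⟩) ∧
      (∀ x y z : I.Cotangent, br (x + y) z = br x z + br y z) ∧
      (∀ x y z : I.Cotangent, br x (y + z) = br x y + br x z) ∧
      (∀ (a : A ⧸ I) (x y : I.Cotangent), br (a • x) y = a • br x y) ∧
      (∀ (a : A ⧸ I) (x y : I.Cotangent), br x (a • y) = a • br x y) ∧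
      (∀ x y : I.Cotangent, br x y = - br y x) ∧
      (∀ x y z : I.Cotangent, br x (br y z) + br y (br z x) + br z (br x y) = 0) := by
  refine ⟨fun f g hf hg => hB.mem_sq_of_left_mem_sq hI hf hg,
    fun a f g hf hg => hB.mul_sub_mem_sq hI a hf hg, ?_⟩
  have hs := I.toCotangent_surjective
  obtain ⟨br, hbr⟩ : ∃ br : I.Cotangent → I.Cotangent → I.Cotangent, ∀ f g : I,
      br (I.toCotangent f) (I.toCotangent g) =
        I.toCotangent ⟨B (f : A) (g : A), hI (f : A) (g : A) g.2⟩ := by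
    choose s hs using hs
    refine ⟨fun x y => I.toCotangent ⟨B (s x) (s y), hI _ _ (s y).2⟩, fun f g => ?_⟩
    exact I.toCotangent_eq.2 (hB.sub_mem_sq hI (s _).2 g.2
      (I.toCotangent_eq.1 (hs _)) (I.toCotangent_eq.1 (hs _)))
  have hanti : ∀ x y, br x y = - br y x := by
    intro x y
    obtain ⟨f, rfl⟩ := hs x
    obtain ⟨g, rfl⟩ := hs y
    rw [hbr, hbr, ← map_neg]
    exact congrArg _ (Subtype.ext (hB.2.2.1 f g))
  have hsmul : ∀ (a : A ⧸ I) (x y : I.Cotangent), br (a • x) y = a • br x y := by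
    intro a x y
    obtain ⟨a, rfl⟩ := Ideal.Quotient.mk_surjective a
    obtain ⟨f, rfl⟩ := hs x
    obtain ⟨g, rfl⟩ := hs y
    change br (a • I.toCotangent f) _ = a • br (I.toCotangent f) _
    rw [← map_smul, hbr, hbr, ← map_smul]
    exact I.toCotangent_eq.2 (hB.mul_sub_mem_sq hI a f.2 g.2)
  have hadd : ∀ x y z, br (x + y) z = br x z + br y z := by
    intro x y z
    obtain ⟨f, rfl⟩ := hs x
    obtain ⟨g, rfl⟩ := hs y
    obtain ⟨h, rfl⟩ := hs z
    rw [← map_add, hbr, hbr, hbr, ← map_add]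
    exact congrArg _ (Subtype.ext (hB.1 f g h))
  refine ⟨br, hbr, hadd, fun x y z => ?_, hsmul, fun a x y => ?_, hanti, fun x y z => ?_⟩
  · rw [hanti, hadd, neg_add, ← hanti, ← hanti]
  · rw [hanti, hsmul, ← smul_neg, ← hanti]
  · obtain ⟨f, rfl⟩ := hs x
    obtain ⟨g, rfl⟩ := hs y
    obtain ⟨h, rfl⟩ := hs z
    simp only [hbr]
    rw [← map_add, ← map_add, ← map_zero I.toCotangent]
    exact congrArg _ (Subtype.ext (hB.2.2.2.1 f g h))
end

section
/- Let n ≥ 1 and let ζ ∈ ℂ be a primitive n-th root of unity. The invariant subalgebra R_n = {p ∈ ℂ[z, z̄, w, w̄] : g_ζ(p) = p} equals the ℂ-subalgebra generated by the 2n + 6 elements z·z̄, w·w̄, z̄·w, z·w̄, together with z^i·w^{n−i} for 0 ≤ i ≤ n and z̄^i·w̄^{n−i} for 0 ≤ i ≤ n (a Hilbert basis for the ℤ/n-action). -/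
open MvPolynomial

/-- The ℂ-algebra endomorphism of ℂ[z, z̄, w, w̄] determined by
`z ↦ ζz, z̄ ↦ ζ⁻¹z̄, w ↦ ζw, w̄ ↦ ζ⁻¹w̄` (variables indexed `0 ↦ z, 1 ↦ z̄, 2 ↦ w, 3 ↦ w̄`). -/
noncomputable def gAut (ζ : ℂ) : MvPolynomial (Fin 4) ℂ →ₐ[ℂ] MvPolynomial (Fin 4) ℂ :=
  aeval ![C ζ * X 0, C ζ⁻¹ * X 1, C ζ * X 2, C ζ⁻¹ * X 3]

/-- If a submonoid contains `x * y`, `u * v`, `y * u`, `x * v` and all monomials of degree `n` in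
`x, u` and in `y, v`, then it contains every monomial whose degree in `x, u` is congruent modulo
`n` to its degree in `y, v`. -/
theorem Submonoid.pow_mul_pow_mem_of_modEq {M : Type*} [CommMonoid M] (S : Submonoid M)
    {x y u v : M} {n : ℕ} (hxy : x * y ∈ S) (huv : u * v ∈ S) (hyu : y * u ∈ S) (hxv : x * v ∈ S)
    (hxu : ∀ i j, i + j = n → x ^ i * u ^ j ∈ S) (hyv : ∀ i j, i + j = n → y ^ i * v ^ j ∈ S) :
    ∀ a b c d : ℕ, a + c ≡ b + d [MOD n] → x ^ a * y ^ b * u ^ c * v ^ d ∈ S := by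
  have pure_mem : ∀ {s t : M}, (∀ i j, i + j = n → s ^ i * t ^ j ∈ S) →
      ∀ k a c, a + c = n * k → s ^ a * t ^ c ∈ S := by
    intro s t hst k
    induction k with
    | zero =>
      intro a c h
      obtain ⟨rfl, rfl⟩ : a = 0 ∧ c = 0 := by simpa using h
      simp
    | succ k ih =>
      intro a c h
      rw [Nat.mul_succ] at h
      obtain ⟨i, j, a', c', hij, rfl, rfl⟩ :
          ∃ i j a' c', i + j = n ∧ a = i + a' ∧ c = j + c' :=
        ⟨min a n, n - min a n, a - min a n, c - (n - min a n), by omega, by omega, by omega⟩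
      rw [pow_add, pow_add, mul_mul_mul_comm]
      exact S.mul_mem (hst i j hij) (ih a' c' (by omega))
  have peel : ∀ {a c b d : ℕ}, a + 1 + c ≡ b + 1 + d [MOD n] → a + c ≡ b + d [MOD n] := by
    intro a c b d h
    refine Nat.ModEq.add_right_cancel' 1 ?_
    simpa only [add_right_comm] using h
  intro a
  induction a with
  | zero =>
    intro b c
    induction c generalizing b with
    | zero =>
      intro d h
      obtain ⟨k, hk⟩ := Nat.modEq_zero_iff_dvd.mp h.symm
      simpa using pure_mem hyv k b d hk
    | succ c ih =>
      intro d h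
      cases b with
      | zero =>
        cases d with
        | zero =>
          obtain ⟨k, hk⟩ := Nat.modEq_zero_iff_dvd.mp h
          simpa using pure_mem hxu k 0 (c + 1) hk
        | succ d =>
          convert S.mul_mem huv (ih 0 d (Nat.ModEq.add_right_cancel' 1 h)) using 1
          simp only [pow_succ]
          ac_rfl
      | succ b =>
        convert S.mul_mem hyu (ih b d (peel (by simpa [add_assoc, add_comm 1] using h))) using 1
        simp only [pow_succ]
        ac_rfl
  | succ a ih =>
    intro b c d h
    cases b with
    | zero =>
      cases d with
      | zero =>
        obtain ⟨k, hk⟩ := Nat.modEq_zero_iff_dvd.mp h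
        simpa using pure_mem hxu k (a + 1) c hk
      | succ d =>
        convert S.mul_mem hxv (ih 0 c d (peel (by simpa [add_assoc, add_comm 1] using h))) using 1
        simp only [pow_succ]
        ac_rfl
    | succ b =>
      convert S.mul_mem hxy (ih b c d (peel h)) using 1
      simp only [pow_succ]
      ac_rfl

theorem monomial_fin_four (m : Fin 4 →₀ ℕ) (r : ℂ) :
    monomial m r = C r * (X 0 ^ m 0 * X 1 ^ m 1 * X 2 ^ m 2 * X 3 ^ m 3) := by
  rw [monomial_eq, Finsupp.prod_fintype _ _ (by simp), Fin.prod_univ_four]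

theorem gAut_monomial (ζ : ℂ) (m : Fin 4 →₀ ℕ) (r : ℂ) :
    gAut ζ (monomial m r) = monomial m (ζ ^ (m 0 + m 2) * ζ⁻¹ ^ (m 1 + m 3) * r) := by
  rw [monomial_fin_four, monomial_fin_four]
  simp only [gAut, map_mul, map_pow, aeval_X, algHom_C, algebraMap_eq, mul_pow, pow_add,
    Matrix.cons_val]
  ring

theorem coeff_gAut (ζ : ℂ) (m : Fin 4 →₀ ℕ) (p : MvPolynomial (Fin 4) ℂ) :
    coeff m (gAut ζ p) = ζ ^ (m 0 + m 2) * ζ⁻¹ ^ (m 1 + m 3) * coeff m p := by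
  induction p using MvPolynomial.induction_on' with
  | monomial k r =>
    rw [gAut_monomial, coeff_monomial, coeff_monomial]
    split_ifs with h
    · rw [h]
    · rw [mul_zero]
  | add p q hp hq => rw [map_add, coeff_add, coeff_add, hp, hq, mul_add]

/-- The invariant algebra of the ℤ/n-action equals the subalgebra generated by the `2n + 6`
elements `z·z̄, w·w̄, z̄·w, z·w̄`, `z^i·w^{n−i}` (0 ≤ i ≤ n) and `z̄^i·w̄^{n−i}` (0 ≤ i ≤ n). -/
theorem invariants_eq_adjoin_hilbertBasis (n : ℕ) (hn : 1 ≤ n) (ζ : ℂ)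
    (hζ : IsPrimitiveRoot ζ n) :
    ∀ p : MvPolynomial (Fin 4) ℂ,
      gAut ζ p = p ↔
        p ∈ Algebra.adjoin ℂ
          (({X 0 * X 1, X 2 * X 3, X 1 * X 2, X 0 * X 3} : Set (MvPolynomial (Fin 4) ℂ)) ∪
            (Set.range fun i : Fin (n + 1) => X 0 ^ (i : ℕ) * X 2 ^ (n - (i : ℕ))) ∪
            (Set.range fun i : Fin (n + 1) => X 1 ^ (i : ℕ) * X 3 ^ (n - (i : ℕ)))) := by
  have hζ0 : ζ ≠ 0 := hζ.ne_zero (by omega)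
  intro p
  constructor
  · intro hp
    rw [p.as_sum]
    refine Subalgebra.sum_mem _ fun m hm => ?_
    rw [monomial_fin_four, ← algebraMap_eq]
    refine Subalgebra.mul_mem _ (Subalgebra.algebraMap_mem _ _) ?_
    have hmod : m 0 + m 2 ≡ m 1 + m 3 [MOD n] := by
      have h := coeff_gAut ζ m p
      rw [hp, eq_comm, mul_eq_right₀ (mem_support_iff.mp hm), inv_pow,
        mul_inv_eq_one₀ (pow_ne_zero _ hζ0)] at h
      rw [hζ.eq_orderOf, ← Units.val_mk0 hζ0, orderOf_units, ← pow_eq_pow_iff_modEq]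
      exact Units.ext (by simpa using h)
    refine Submonoid.pow_mul_pow_mem_of_modEq (M := MvPolynomial (Fin 4) ℂ)
      (Algebra.adjoin ℂ _).toSubsemiring.toSubmonoid ?_ ?_ ?_ ?_ ?_ ?_ _ _ _ _ hmod
    iterate 4 exact Algebra.subset_adjoin (by simp)
    · rintro i j rfl
      exact Algebra.subset_adjoin (Or.inl (Or.inr ⟨⟨i, by omega⟩, by simp⟩))
    · rintro i j rfl
      exact Algebra.subset_adjoin (Or.inr ⟨⟨i, by omega⟩, by simp⟩)
  · intro hp
    suffices h : Algebra.adjoin ℂ _ ≤ AlgHom.equalizer (gAut ζ) (AlgHom.id ℂ _) from h hp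
    have hC : (C ζ * C ζ⁻¹ : MvPolynomial (Fin 4) ℂ) = 1 := by
      rw [← C_mul, mul_inv_cancel₀ hζ0, C_1]
    have hpow : ∀ {ξ : ℂ}, ξ ^ n = 1 → ∀ (i : Fin (n + 1)) (x y : MvPolynomial (Fin 4) ℂ),
        (C ξ * x) ^ (i : ℕ) * (C ξ * y) ^ (n - (i : ℕ)) = x ^ (i : ℕ) * y ^ (n - (i : ℕ)) := by
      intro ξ hξ i x y
      rw [mul_pow, mul_pow, mul_mul_mul_comm, ← pow_add, Nat.add_sub_cancel' (by omega), ← C_pow,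
        hξ, C_1, one_mul]
    rw [Algebra.adjoin_le_iff]
    rintro _ ((h | ⟨i, rfl⟩) | ⟨i, rfl⟩)
    · rcases h with rfl | rfl | rfl | rfl <;>
        simp only [SetLike.mem_coe, AlgHom.mem_equalizer, AlgHom.id_apply, gAut, map_mul, aeval_X,
          Matrix.cons_val]
      · linear_combination (X 0 * X 1) * hC
      · linear_combination (X 2 * X 3) * hC
      · linear_combination (X 1 * X 2) * hC
      · linear_combination (X 0 * X 3) * hC
    · simpa [AlgHom.mem_equalizer, gAut] using hpow hζ.pow_eq_one i (X 0) (X 2)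
    · simpa [AlgHom.mem_equalizer, gAut] using hpow hζ.inv.pow_eq_one i (X 1) (X 3)
end

section
/- Fix an integer n ≥ 1. On the polynomial ring ℂ[x, y, z] define the bracket {f, g} := (−2n·z)·(∂f/∂x·∂g/∂y − ∂f/∂y·∂g/∂x) + (2n·y)·(∂f/∂x·∂g/∂z − ∂f/∂z·∂g/∂x) + (4n²·x^{n−1})·(∂f/∂y·∂g/∂z − ∂f/∂z·∂g/∂y). Then: (a) this bracket satisfies the Jacobi identity (it is a Poisson bracket, since bilinearity, antisymmetry and the Leibniz rule hold by construction); and (b) the ℂ-algebra homomorphism F : ℂ[x, y, z] → ℂ[z, z̄] determined by x ↦ z·z̄, y ↦ zⁿ + z̄ⁿ, z ↦ i·(zⁿ − z̄ⁿ) intertwines brackets: F({f, g}) = {F f, F g}₀ for all f, g, where {p, q}₀ := 2i·(∂p/∂z·∂q/∂z̄ − ∂p/∂z̄·∂q/∂z) on ℂ[z, z̄]. (This realizes the symplectic orbifold ℝ²/ℤ_n as a Poisson subvariety of 3-space.) -/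
open MvPolynomial

/-- The bracket on ℂ[x, y, z] with structure functions `{x,y} = −2n z`, `{x,z} = 2n y`,
`{y,z} = 4n² x^{n−1}` (variables indexed `0 ↦ x, 1 ↦ y, 2 ↦ z`). -/
noncomputable def orbBr (n : ℕ) (f g : MvPolynomial (Fin 3) ℂ) : MvPolynomial (Fin 3) ℂ :=
  (C (-(2 * (n : ℂ))) * X 2) * (pderiv 0 f * pderiv 1 g - pderiv 1 f * pderiv 0 g) +
  (C (2 * (n : ℂ)) * X 1) * (pderiv 0 f * pderiv 2 g - pderiv 2 f * pderiv 0 g) +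
  (C (4 * (n : ℂ) ^ 2) * X 0 ^ (n - 1)) * (pderiv 1 f * pderiv 2 g - pderiv 2 f * pderiv 1 g)

/-- The bracket `{p, q}₀ := 2i·(p_z q_z̄ − p_z̄ q_z)` on ℂ[z, z̄]
(variables indexed `0 ↦ z, 1 ↦ z̄`). -/
noncomputable def kahlerBr (p q : MvPolynomial (Fin 2) ℂ) : MvPolynomial (Fin 2) ℂ :=
  C (2 * Complex.I) * (pderiv 0 p * pderiv 1 q - pderiv 1 p * pderiv 0 q)

/-- The Hilbert-map pullback `x ↦ z·z̄, y ↦ zⁿ + z̄ⁿ, z ↦ i·(zⁿ − z̄ⁿ)`. -/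
noncomputable def orbHilbert (n : ℕ) : MvPolynomial (Fin 3) ℂ →ₐ[ℂ] MvPolynomial (Fin 2) ℂ :=
  aeval ![X 0 * X 1, X 0 ^ n + X 1 ^ n, C Complex.I * (X 0 ^ n - X 1 ^ n)]

/-- Formal partial derivatives commute. -/
theorem MvPolynomial.pderiv_pderiv_swap {σ R : Type*} [CommRing R] (i j : σ)
    (f : MvPolynomial σ R) : pderiv i (pderiv j f) = pderiv j (pderiv i f) := by
  classical
  have h : ⁅pderiv (R := R) i, pderiv (R := R) j⁆ = 0 := by
    apply MvPolynomial.derivation_ext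
    intro k
    simp only [Derivation.commutator_apply, pderiv_X, Derivation.zero_apply, Pi.single_apply]
    split_ifs <;> simp
  have := DFunLike.congr_fun h f
  rwa [Derivation.commutator_apply, Derivation.zero_apply, sub_eq_zero] at this

/-- The chain rule for polynomial substitution. -/
theorem MvPolynomial.pderiv_aeval {σ τ R : Type*} [Fintype σ] [CommSemiring R]
    (v : σ → MvPolynomial τ R) (j : τ) (f : MvPolynomial σ R) :
    pderiv j (aeval v f) = ∑ i, aeval v (pderiv i f) * pderiv j (v i) := by
  classical
  induction f using MvPolynomial.induction_on with
  | C a => simp [algebraMap_eq]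
  | add p q hp hq => simp only [map_add, hp, hq, add_mul, Finset.sum_add_distrib]
  | mul_X p k hp =>
    simp only [map_mul, aeval_X, Derivation.leibniz, hp, smul_eq_mul, map_add, add_mul,
      Finset.sum_add_distrib, Finset.mul_sum, pderiv_X, Pi.single_apply, apply_ite (aeval v),
      map_zero, mul_ite, ite_mul, mul_one, mul_zero, zero_mul, Finset.sum_ite_eq,
      Finset.mem_univ, if_true, mul_assoc]

/-- The bracket `orbBr` satisfies the Jacobi identity: its structure functions form the gradient
of a polynomial. -/
theorem orbBr_jacobi (n : ℕ) (f g h : MvPolynomial (Fin 3) ℂ) :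
    orbBr n f (orbBr n g h) + orbBr n g (orbBr n h f) + orbBr n h (orbBr n f g) = 0 := by
  unfold orbBr
  simp only [map_add, map_sub, Derivation.leibniz, pderiv_C, smul_eq_mul, Derivation.leibniz_pow,
    pderiv_X_self, pderiv_X_of_ne (show (0 : Fin 3) ≠ 1 by decide),
    pderiv_X_of_ne (show (0 : Fin 3) ≠ 2 by decide),
    pderiv_X_of_ne (show (1 : Fin 3) ≠ 0 by decide),
    pderiv_X_of_ne (show (1 : Fin 3) ≠ 2 by decide),
    pderiv_X_of_ne (show (2 : Fin 3) ≠ 0 by decide),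
    pderiv_X_of_ne (show (2 : Fin 3) ≠ 1 by decide),
    pderiv_pderiv_swap (1 : Fin 3) 0, pderiv_pderiv_swap (2 : Fin 3) 0,
    pderiv_pderiv_swap (2 : Fin 3) 1,
    smul_zero, mul_zero, add_zero, map_neg]
  ring

/-- The Hilbert map intertwines `orbBr` with the Kähler bracket. -/
theorem orbHilbert_orbBr (n : ℕ) (hn : 1 ≤ n) (f g : MvPolynomial (Fin 3) ℂ) :
    orbHilbert n (orbBr n f g) = kahlerBr (orbHilbert n f) (orbHilbert n g) := by
  obtain ⟨m, rfl⟩ := Nat.exists_eq_add_of_le' hn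
  have hI : (C Complex.I : MvPolynomial (Fin 2) ℂ) ^ 2 = -1 := by
    rw [← map_pow, Complex.I_sq, map_neg, map_one]
  unfold orbBr kahlerBr orbHilbert
  simp only [pderiv_aeval, Fin.sum_univ_three, map_add, map_sub, map_mul, aeval_X,
    map_pow, map_neg, Matrix.cons_val, Derivation.leibniz, Derivation.leibniz_pow,
    pderiv_C, pderiv_X_self, pderiv_X_of_ne (show (0 : Fin 2) ≠ 1 by decide),
    pderiv_X_of_ne (show (1 : Fin 2) ≠ 0 by decide), smul_eq_mul, nsmul_eq_mul, mul_zero, mul_one,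
    add_zero, zero_add, Nat.add_sub_cancel, mul_pow, map_natCast, map_ofNat, sub_zero, zero_sub]
  generalize (C Complex.I : MvPolynomial (Fin 2) ℂ) = c at *
  set F := aeval (R := ℂ)
    ![X 0 * X 1, X 0 ^ (m + 1) + X 1 ^ (m + 1), c * (X 0 ^ (m + 1) - X 1 ^ (m + 1))]
  push_cast
  linear_combination
    (2 * (m + 1) * (X 0 ^ (m + 1) + X 1 ^ (m + 1)) *
        (F (pderiv 0 f) * F (pderiv 2 g) - F (pderiv 2 f) * F (pderiv 0 g)) +
      4 * (m + 1) ^ 2 * (X 0 ^ m * X 1 ^ m) *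
        (F (pderiv 1 f) * F (pderiv 2 g) - F (pderiv 2 f) * F (pderiv 1 g))) * hI

/-- (a) The bracket `orbBr n` satisfies the Jacobi identity, and (b) the Hilbert map `F`
intertwines it with `{·,·}₀ = 2i(∂_z ∧ ∂_z̄)`: this realizes ℝ²/ℤ_n as a Poisson subvariety
of 3-space. -/
theorem orbifold_Zn_poisson_embedding (n : ℕ) (hn : 1 ≤ n) :
    (∀ f g h : MvPolynomial (Fin 3) ℂ,
      orbBr n f (orbBr n g h) + orbBr n g (orbBr n h f) + orbBr n h (orbBr n f g) = 0) ∧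
    (∀ f g : MvPolynomial (Fin 3) ℂ,
      orbHilbert n (orbBr n f g) = kahlerBr (orbHilbert n f) (orbHilbert n g)) :=
  ⟨orbBr_jacobi n, orbHilbert_orbBr n hn⟩
end

section
/- Fix an integer n ≥ 1 and let F : ℂ[x, y, z] → ℂ[z, z̄] be the ℂ-algebra homomorphism determined by x ↦ z·z̄, y ↦ zⁿ + z̄ⁿ, z ↦ i·(zⁿ − z̄ⁿ). Then the kernel of F is the principal ideal of ℂ[x, y, z] generated by y² + z² − 4·xⁿ. (This realizes the quotient ℝ²/ℤ_n as the affine variety V(y² + z² − 4xⁿ).) -/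
open MvPolynomial

/-- Over `ℂ`, the map `(u, v) ↦ (u v, uⁿ + vⁿ)` is surjective for `n ≥ 1`. -/
lemma exists_mul_eq_and_pow_add_pow_eq {n : ℕ} (hn : 1 ≤ n) (a b : ℂ) :
    ∃ u v : ℂ, u * v = a ∧ u ^ n + v ^ n = b := by
  have hn0 : n ≠ 0 := by omega
  by_cases ha : a = 0
  · obtain ⟨u, hu⟩ := IsAlgClosed.exists_pow_nat_eq b hn
    exact ⟨u, 0, by simp [ha], by simp [hu, hn0]⟩
  · obtain ⟨d, hd⟩ := IsAlgClosed.exists_pow_nat_eq (b ^ 2 - 4 * a ^ n) two_pos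
    obtain ⟨u, hu⟩ := IsAlgClosed.exists_pow_nat_eq ((b + d) / 2) hn
    have han : a ^ n ≠ 0 := pow_ne_zero _ ha
    have hprod : (b + d) / 2 * ((b - d) / 2) = a ^ n := by linear_combination -hd / 4
    have hs : (b + d) / 2 ≠ 0 := fun h => han (by rw [← hprod, h, zero_mul])
    have hu0 : u ≠ 0 := by
      rintro rfl
      exact hs (by rw [← hu, zero_pow hn0])
    refine ⟨u, a / u, mul_div_cancel₀ a hu0, ?_⟩
    rw [div_pow, hu, ← hprod, mul_div_cancel_left₀ _ hs]
    ring

/-- The invariants `z z̄` and `zⁿ + z̄ⁿ` are algebraically independent. -/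
lemma algebraicIndependent_mul_pow_add_pow {n : ℕ} (hn : 1 ≤ n) :
    AlgebraicIndependent ℂ
      (![X 0 * X 1, X 0 ^ n + X 1 ^ n] : Fin 2 → MvPolynomial (Fin 2) ℂ) := by
  rw [algebraicIndependent_iff]
  intro p hp
  refine MvPolynomial.funext fun w => ?_
  obtain ⟨u, v, huv, hadd⟩ := exists_mul_eq_and_pow_add_pow_eq hn (w 0) (w 1)
  have h := congrArg (aeval ![u, v] : MvPolynomial (Fin 2) ℂ →ₐ[ℂ] ℂ) hp
  rw [← AlgHom.comp_apply, comp_aeval, map_zero] at h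
  have hw : (fun i => (aeval ![u, v] : MvPolynomial (Fin 2) ℂ →ₐ[ℂ] ℂ)
      ((![X 0 * X 1, X 0 ^ n + X 1 ^ n] : Fin 2 → MvPolynomial (Fin 2) ℂ) i)) = w := by
    ext i
    fin_cases i <;> simp [huv, hadd]
  rw [hw] at h
  simpa [aeval_eq_eval] using h

/-- Modulo `y² + z² − 4xⁿ`, every polynomial is of the form `A(x, y) + z B(x, y)`. -/
lemma exists_sub_mem_span_orbifold_relation (n : ℕ) (p : MvPolynomial (Fin 3) ℂ) :
    ∃ A B : MvPolynomial (Fin 2) ℂ,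
      p - (rename Fin.castSucc A + X 2 * rename Fin.castSucc B) ∈
        Ideal.span {(X 1 ^ 2 + X 2 ^ 2 - C 4 * X 0 ^ n : MvPolynomial (Fin 3) ℂ)} := by
  simp only [Ideal.mem_span_singleton']
  induction p using MvPolynomial.induction_on with
  | C a => exact ⟨C a, 0, 0, by simp⟩
  | add p q hp hq =>
    obtain ⟨A, B, c, h⟩ := hp
    obtain ⟨A', B', c', h'⟩ := hq
    refine ⟨A + A', B + B', c + c', ?_⟩
    simp only [map_add]
    linear_combination h + h'
  | mul_X p i hp =>
    obtain ⟨A, B, c, h⟩ := hp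
    fin_cases i
    · refine ⟨A * X 0, B * X 0, c * X 0, ?_⟩
      simp only [map_mul, rename_X, Fin.castSucc_zero, Fin.zero_eta]
      linear_combination X 0 * h
    · refine ⟨A * X 1, B * X 1, c * X 1, ?_⟩
      simp only [map_mul, rename_X, Fin.castSucc_one, Fin.mk_one]
      linear_combination X 1 * h
    · refine ⟨(C 4 * X 0 ^ n - X 1 ^ 2) * B, A, c * X 2 + rename Fin.castSucc B, ?_⟩
      simp only [map_mul, map_sub, map_pow, rename_X, rename_C, Fin.castSucc_zero,
        Fin.castSucc_one, Fin.reduceFinMk]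
      linear_combination X 2 * h

lemma X_pow_sub_X_pow_ne_zero {n : ℕ} (hn : 1 ≤ n) :
    (X 0 ^ n - X 1 ^ n : MvPolynomial (Fin 2) ℂ) ≠ 0 := by
  intro h
  have := congrArg (eval ![1, 0]) h
  simp [show n ≠ 0 by omega] at this

lemma orbHilbert_rename_castSucc (n : ℕ) (A : MvPolynomial (Fin 2) ℂ) :
    orbHilbert n (rename Fin.castSucc A) = aeval ![X 0 * X 1, X 0 ^ n + X 1 ^ n] A := by
  rw [orbHilbert, aeval_rename]
  congr 2
  ext1 i
  fin_cases i <;> rfl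

/-- Invariants in `z z̄` and `zⁿ + z̄ⁿ` are fixed by exchanging `z` and `z̄`. -/
lemma rename_swap_aeval_mul_pow_add_pow (n : ℕ) (A : MvPolynomial (Fin 2) ℂ) :
    rename (Equiv.swap 0 1)
        (aeval (![X 0 * X 1, X 0 ^ n + X 1 ^ n] : Fin 2 → MvPolynomial (Fin 2) ℂ) A) =
      aeval (![X 0 * X 1, X 0 ^ n + X 1 ^ n] : Fin 2 → MvPolynomial (Fin 2) ℂ) A := by
  rw [← AlgHom.comp_apply, comp_aeval]
  congr 2
  ext1 i
  fin_cases i <;> simp [mul_comm, add_comm]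

lemma orbHilbert_relation (n : ℕ) :
    orbHilbert n (X 1 ^ 2 + X 2 ^ 2 - C 4 * X 0 ^ n) = 0 := by
  have hI : (C Complex.I : MvPolynomial (Fin 2) ℂ) ^ 2 = -1 := by
    rw [← C_pow, Complex.I_sq, C_neg, C_1]
  have h4 : (C 4 : MvPolynomial (Fin 2) ℂ) = 4 := map_ofNat C 4
  simp only [orbHilbert, map_sub, map_add, map_mul, map_pow, aeval_X, aeval_C, algebraMap_eq, h4,
    Matrix.cons_val]
  linear_combination (X 0 ^ n - X 1 ^ n) ^ 2 * hI

/-- The kernel of the Hilbert map is the principal ideal generated by `y² + z² − 4xⁿ`: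
the quotient ℝ²/ℤ_n is the affine variety `V(y² + z² − 4xⁿ)`. -/
theorem orbifold_Zn_kernel (n : ℕ) (hn : 1 ≤ n) :
    RingHom.ker (orbHilbert n) =
      Ideal.span {X 1 ^ 2 + X 2 ^ 2 - C 4 * X 0 ^ n} := by
  have hle : Ideal.span {(X 1 ^ 2 + X 2 ^ 2 - C 4 * X 0 ^ n : MvPolynomial (Fin 3) ℂ)} ≤
      RingHom.ker (orbHilbert n) := by
    rw [Ideal.span_singleton_le_iff_mem]
    exact orbHilbert_relation n
  refine le_antisymm (fun p hp => ?_) hle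
  obtain ⟨A, B, hAB⟩ := exists_sub_mem_span_orbifold_relation n p
  have h := hle hAB
  rw [RingHom.mem_ker] at hp h
  have hX : orbHilbert n (X 2) = C Complex.I * (X 0 ^ n - X 1 ^ n) := by simp [orbHilbert]
  rw [map_sub, hp, map_add, map_mul, orbHilbert_rename_castSucc, orbHilbert_rename_castSucc,
    hX] at h
  have hswap := congrArg (rename (Equiv.swap (0 : Fin 2) 1)) h
  simp only [map_sub, map_add, map_mul, map_pow, map_zero, rename_swap_aeval_mul_pow_add_pow,
    rename_X, rename_C, Equiv.swap_apply_left, Equiv.swap_apply_right] at hswap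
  have hA : aeval (![X 0 * X 1, X 0 ^ n + X 1 ^ n] : Fin 2 → MvPolynomial (Fin 2) ℂ) A = 0 := by
    have h2 : (2 : MvPolynomial (Fin 2) ℂ) ≠ 0 := two_ne_zero
    refine (mul_eq_zero.mp ?_).resolve_left h2
    linear_combination -h - hswap
  have hB : aeval (![X 0 * X 1, X 0 ^ n + X 1 ^ n] : Fin 2 → MvPolynomial (Fin 2) ℂ) B = 0 := by
    rw [hA, zero_add, zero_sub, neg_eq_zero] at h
    refine (mul_eq_zero.mp h).resolve_left (mul_ne_zero ?_ (X_pow_sub_X_pow_ne_zero hn))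
    simp
  have hind := algebraicIndependent_iff.mp (algebraicIndependent_mul_pow_add_pow hn)
  simpa [hind A hA, hind B hB] using hAB
end

section
/- Fix an integer n ≥ 1. On the polynomial ring ℂ[u, v, w] define the bracket {f, g} := (−n·v)·(∂f/∂u·∂g/∂v − ∂f/∂v·∂g/∂u) + (n·w)·(∂f/∂u·∂g/∂w − ∂f/∂w·∂g/∂u) + (n²·u^{n−1})·(∂f/∂v·∂g/∂w − ∂f/∂w·∂g/∂v). Then: (a) this bracket satisfies the Jacobi identity; and (b) the ℂ-algebra homomorphism F : ℂ[u, v, w] → ℂ[x, y] determined by u ↦ x·y, v ↦ xⁿ, w ↦ yⁿ intertwines brackets: F({f, g}) = {F f, F g}_std for all f, g. (This realizes the A_n Kleinian singularity ℂ²/ℤ_n as a Poisson subvariety of ℂ³.) -/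
open MvPolynomial

/-- The bracket on ℂ[u, v, w] with structure functions `{u,v} = −n v`, `{u,w} = n w`,
`{v,w} = n² u^{n−1}` (variables indexed `0 ↦ u, 1 ↦ v, 2 ↦ w`). -/
noncomputable def anBr (n : ℕ) (f g : MvPolynomial (Fin 3) ℂ) : MvPolynomial (Fin 3) ℂ :=
  (C (-(n : ℂ)) * X 1) * (pderiv 0 f * pderiv 1 g - pderiv 1 f * pderiv 0 g) +
  (C (n : ℂ) * X 2) * (pderiv 0 f * pderiv 2 g - pderiv 2 f * pderiv 0 g) +
  (C ((n : ℂ) ^ 2) * X 0 ^ (n - 1)) * (pderiv 1 f * pderiv 2 g - pderiv 2 f * pderiv 1 g)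

/-- The standard symplectic bracket `{p, q} = p_x q_y − p_y q_x` on ℂ[x, y]. -/
noncomputable def stdBr (p q : MvPolynomial (Fin 2) ℂ) : MvPolynomial (Fin 2) ℂ :=
  pderiv 0 p * pderiv 1 q - pderiv 1 p * pderiv 0 q

/-- The Hilbert-map pullback `u ↦ x·y, v ↦ xⁿ, w ↦ yⁿ`. -/
noncomputable def anHilbert (n : ℕ) : MvPolynomial (Fin 3) ℂ →ₐ[ℂ] MvPolynomial (Fin 2) ℂ :=
  aeval ![X 0 * X 1, X 0 ^ n, X 1 ^ n]

/-- Partial derivatives of polynomials commute. -/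
theorem MvPolynomial.pderiv_pderiv_comm {R σ : Type*} [CommRing R] (i j : σ)
    (f : MvPolynomial σ R) : pderiv i (pderiv j f) = pderiv j (pderiv i f) := by
  classical
  have h : ⁅pderiv (R := R) i, pderiv (R := R) j⁆ = 0 := by
    refine MvPolynomial.derivation_ext fun k => ?_
    simp [Derivation.commutator_apply, pderiv_X, Pi.single_apply, apply_ite]
  simpa [Derivation.commutator_apply, sub_eq_zero] using congrArg (fun D => D f) h

/-- The chain rule for the partial derivatives of a polynomial substitution. -/
theorem MvPolynomial.pderiv_bind₁ {R σ τ : Type*} [CommSemiring R] [Fintype σ]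
    (s : σ → MvPolynomial τ R) (i : τ) (f : MvPolynomial σ R) :
    pderiv i (bind₁ s f) = ∑ j, bind₁ s (pderiv j f) * pderiv i (s j) := by
  classical
  induction f using MvPolynomial.induction_on with
  | C a => simp
  | add p q hp hq => simp [hp, hq, add_mul, Finset.sum_add_distrib]
  | mul_X p k hp =>
    simp [hp, add_mul, Finset.sum_add_distrib, pderiv_X, Pi.single_apply,
      apply_ite (bind₁ s), Finset.mul_sum, mul_assoc]

/-- The bracket `anBr n` satisfies the Jacobi identity. -/
theorem anBr_jacobi (n : ℕ) (f g h : MvPolynomial (Fin 3) ℂ) :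
    anBr n f (anBr n g h) + anBr n g (anBr n h f) + anBr n h (anBr n f g) = 0 := by
  have hX (i j : Fin 3) (hij : j ≠ i) : pderiv i (X j : MvPolynomial (Fin 3) ℂ) = 0 :=
    pderiv_X_of_ne hij
  simp only [anBr, map_add, map_sub, pderiv_mul, pderiv_C, pderiv_pow, pderiv_X_self,
    hX 0 1 (by decide), hX 0 2 (by decide), hX 1 0 (by decide), hX 1 2 (by decide),
    hX 2 0 (by decide), hX 2 1 (by decide),
    pderiv_pderiv_comm (1 : Fin 3) 0, pderiv_pderiv_comm (2 : Fin 3) 0,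
    pderiv_pderiv_comm (2 : Fin 3) 1, map_neg]
  ring

/-- The Hilbert map intertwines `anBr n` with the standard symplectic bracket. -/
theorem anHilbert_anBr (n : ℕ) (f g : MvPolynomial (Fin 3) ℂ) :
    anHilbert n (anBr n f g) = stdBr (anHilbert n f) (anHilbert n g) := by
  have h01 : pderiv 0 (X 1 : MvPolynomial (Fin 2) ℂ) = 0 := pderiv_X_of_ne (by decide)
  have h10 : pderiv 1 (X 0 : MvPolynomial (Fin 2) ℂ) = 0 := pderiv_X_of_ne (by decide)
  rcases n with _ | n
  · simp [anHilbert, anBr, stdBr, pderiv_bind₁, Fin.sum_univ_three, h01, h10]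
    ring
  · simp [anHilbert, anBr, stdBr, pderiv_bind₁, Fin.sum_univ_three, h01, h10]
    ring

/-- (a) The bracket `anBr n` satisfies the Jacobi identity, and (b) the Hilbert map
intertwines it with the standard symplectic bracket: this realizes the `A_n` Kleinian
singularity ℂ²/ℤ_n as a Poisson subvariety of ℂ³. -/
theorem An_singularity_poisson_embedding (n : ℕ) (hn : 1 ≤ n) :
    (∀ f g h : MvPolynomial (Fin 3) ℂ,
      anBr n f (anBr n g h) + anBr n g (anBr n h f) + anBr n h (anBr n f g) = 0) ∧
    (∀ f g : MvPolynomial (Fin 3) ℂ,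
      anHilbert n (anBr n f g) = stdBr (anHilbert n f) (anHilbert n g)) :=
  ⟨anBr_jacobi n, anHilbert_anBr n⟩
end

section
/- Fix an integer n ≥ 2, set φ := v·w − uⁿ ∈ ℂ[u, v, w], and let α₁, α₂, α₃ ∈ ℂ[u, v, w] be arbitrary. Put P := ∂φ/∂u + φ·α₁, Q := ∂φ/∂v + φ·α₂, R := ∂φ/∂w + φ·α₃, and define the bracket {f, g} := R·(∂f/∂u·∂g/∂v − ∂f/∂v·∂g/∂u) − Q·(∂f/∂u·∂g/∂w − ∂f/∂w·∂g/∂u) + P·(∂f/∂v·∂g/∂w − ∂f/∂w·∂g/∂v) on ℂ[u, v, w]. Then this bracket satisfies the Jacobi identity if and only if the polynomial identity P·(∂α₃/∂v − ∂α₂/∂w) − Q·(∂α₃/∂u − ∂α₁/∂w) + R·(∂α₂/∂u − ∂α₁/∂v) = 0 holds. (In differential-form language: the bivector ∇(∗φ) + φ·(∗α) is Poisson iff (dφ + φα)∧dα = 0; this classifies the Poisson structures on ℂ³ of this form extending the bracket on ℂ²/ℤ_n.) -/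
open MvPolynomial

namespace MvPolynomial

theorem pderiv_pderiv_comm_s13 {σ A : Type*} [CommRing A] (i j : σ) (p : MvPolynomial σ A) :
    pderiv i (pderiv j p) = pderiv j (pderiv i p) := by
  classical
  have h : ⁅pderiv (R := A) i, pderiv (R := A) j⁆ = 0 := by
    refine derivation_ext fun k => ?_
    rw [Derivation.commutator_apply, pderiv_X, pderiv_X]
    by_cases hi : i = k <;> by_cases hj : j = k <;> simp [hi, hj]
  have h' := congrArg (fun D => D p) h
  rw [Derivation.commutator_apply] at h'
  exact sub_eq_zero.mp h'

variable {A : Type*} [CommRing A]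

/-- The bracket on `A[u, v, w]` with `{v, w} = P`, `{w, u} = Q` and `{u, v} = R`. -/
noncomputable def bivectorBracket (P Q R f g : MvPolynomial (Fin 3) A) :
    MvPolynomial (Fin 3) A :=
  R * (pderiv 0 f * pderiv 1 g - pderiv 1 f * pderiv 0 g)
    - Q * (pderiv 0 f * pderiv 2 g - pderiv 2 f * pderiv 0 g)
    + P * (pderiv 1 f * pderiv 2 g - pderiv 2 f * pderiv 1 g)

/-- The coefficient of `du ∧ dv ∧ dw` in `ω ∧ dη`, where `ω = P du + Q dv + R dw` and
`η = a du + b dv + c dw`. -/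
noncomputable def wedgeExtDeriv (P Q R a b c : MvPolynomial (Fin 3) A) :
    MvPolynomial (Fin 3) A :=
  P * (pderiv 1 c - pderiv 2 b) - Q * (pderiv 0 c - pderiv 2 a)
    + R * (pderiv 0 b - pderiv 1 a)

/-- The Jacobiator of the bracket attached to `ω` is `-(ω ∧ dω)` times the Jacobian determinant. -/
theorem bivectorBracket_jacobiator (P Q R f g h : MvPolynomial (Fin 3) A) :
    bivectorBracket P Q R f (bivectorBracket P Q R g h)
        + bivectorBracket P Q R g (bivectorBracket P Q R h f)
        + bivectorBracket P Q R h (bivectorBracket P Q R f g)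
      = -wedgeExtDeriv P Q R P Q R *
        (pderiv 0 f * (pderiv 1 g * pderiv 2 h - pderiv 2 g * pderiv 1 h)
          - pderiv 1 f * (pderiv 0 g * pderiv 2 h - pderiv 2 g * pderiv 0 h)
          + pderiv 2 f * (pderiv 0 g * pderiv 1 h - pderiv 1 g * pderiv 0 h)) := by
  simp only [bivectorBracket, wedgeExtDeriv, map_add, map_sub, pderiv_mul,
    pderiv_pderiv_comm_s13 (1 : Fin 3) 0, pderiv_pderiv_comm_s13 (2 : Fin 3) 0,
    pderiv_pderiv_comm_s13 (2 : Fin 3) 1]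
  ring

/-- The Jacobi identity for the bracket attached to `ω` is the integrability `ω ∧ dω = 0`. -/
theorem bivectorBracket_jacobi_iff (P Q R : MvPolynomial (Fin 3) A) :
    (∀ f g h, bivectorBracket P Q R f (bivectorBracket P Q R g h)
        + bivectorBracket P Q R g (bivectorBracket P Q R h f)
        + bivectorBracket P Q R h (bivectorBracket P Q R f g) = 0)
      ↔ wedgeExtDeriv P Q R P Q R = 0 := by
  simp only [bivectorBracket_jacobiator]
  refine ⟨fun H => ?_, fun H f g h => by rw [H, neg_zero, zero_mul]⟩
  simpa [pderiv_X, Pi.single_apply] using H (X 0) (X 1) (X 2)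

/-- For `ω = dφ + φ α` one has `ω ∧ dω = φ (ω ∧ dα)`. -/
theorem wedgeExtDeriv_pderiv_add_mul (φ a b c : MvPolynomial (Fin 3) A) :
    wedgeExtDeriv (pderiv 0 φ + φ * a) (pderiv 1 φ + φ * b) (pderiv 2 φ + φ * c)
        (pderiv 0 φ + φ * a) (pderiv 1 φ + φ * b) (pderiv 2 φ + φ * c)
      = φ * wedgeExtDeriv (pderiv 0 φ + φ * a) (pderiv 1 φ + φ * b) (pderiv 2 φ + φ * c)
        a b c := by
  simp only [wedgeExtDeriv, map_add, pderiv_mul,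
    pderiv_pderiv_comm_s13 (1 : Fin 3) 0, pderiv_pderiv_comm_s13 (2 : Fin 3) 0,
    pderiv_pderiv_comm_s13 (2 : Fin 3) 1]
  ring

theorem X_mul_X_sub_X_pow_ne_zero [Nontrivial A] {n : ℕ} (hn : n ≠ 0) :
    (X 1 * X 2 - X 0 ^ n : MvPolynomial (Fin 3) A) ≠ 0 := by
  intro h
  simpa [hn] using congrArg (eval ![0, 1, 1]) h

end MvPolynomial

/-- For `φ = v·w − uⁿ` and arbitrary `α₁, α₂, α₃`, the bracket on ℂ[u, v, w] with structure
functions `P = φ_u + φα₁`, `Q = φ_v + φα₂`, `R = φ_w + φα₃` (i.e.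
`{f,g} = R(f_u g_v − f_v g_u) − Q(f_u g_w − f_w g_u) + P(f_v g_w − f_w g_v)`) satisfies the
Jacobi identity iff `P(∂_v α₃ − ∂_w α₂) − Q(∂_u α₃ − ∂_w α₁) + R(∂_u α₂ − ∂_v α₁) = 0`,
i.e. `(dφ + φα) ∧ dα = 0`. Variables are indexed `0 ↦ u, 1 ↦ v, 2 ↦ w`. -/
theorem An_extension_jacobi_iff (n : ℕ) (hn : 2 ≤ n)
    (α₁ α₂ α₃ P Q R : MvPolynomial (Fin 3) ℂ)
    (hP : P = pderiv 0 (X 1 * X 2 - X 0 ^ n) + (X 1 * X 2 - X 0 ^ n) * α₁)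
    (hQ : Q = pderiv 1 (X 1 * X 2 - X 0 ^ n) + (X 1 * X 2 - X 0 ^ n) * α₂)
    (hR : R = pderiv 2 (X 1 * X 2 - X 0 ^ n) + (X 1 * X 2 - X 0 ^ n) * α₃)
    (br : MvPolynomial (Fin 3) ℂ → MvPolynomial (Fin 3) ℂ → MvPolynomial (Fin 3) ℂ)
    (hbr : ∀ f g,
      br f g = R * (pderiv 0 f * pderiv 1 g - pderiv 1 f * pderiv 0 g)
        - Q * (pderiv 0 f * pderiv 2 g - pderiv 2 f * pderiv 0 g)
        + P * (pderiv 1 f * pderiv 2 g - pderiv 2 f * pderiv 1 g)) :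
    (∀ f g h : MvPolynomial (Fin 3) ℂ,
        br f (br g h) + br g (br h f) + br h (br f g) = 0) ↔
      P * (pderiv 1 α₃ - pderiv 2 α₂) - Q * (pderiv 0 α₃ - pderiv 2 α₁)
        + R * (pderiv 0 α₂ - pderiv 1 α₁) = 0 := by
  have hbr' : br = bivectorBracket P Q R := funext₂ hbr
  rw [hbr', bivectorBracket_jacobi_iff, hP, hQ, hR, wedgeExtDeriv_pderiv_add_mul, mul_eq_zero,
    or_iff_right (X_mul_X_sub_X_pow_ne_zero (by lia))]
  rfl
end

section
/- Fix positive integers a, b. On ℂ[x₁, x₂, x₃, x₄] define the bracket determined by the structure functions {x₁, x₂} = 0, {x₁, x₃} = 2b·x₄, {x₁, x₄} = −2b·x₃, {x₂, x₃} = −2a·x₄, {x₂, x₄} = 2a·x₃, {x₃, x₄} = 4·x₁^{b−1}·x₂^{a−1}·(a²·x₁ − b²·x₂), extended to all polynomials as a biderivation in each argument. Then: (a) this bracket satisfies the Jacobi identity; and (b) the ℂ-algebra homomorphism F : ℂ[x₁, x₂, x₃, x₄] → ℂ[z, z̄, w, w̄] determined by x₁ ↦ z·z̄, x₂ ↦ w·w̄,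 x₃ ↦ zᵇ·w̄ᵃ + z̄ᵇ·wᵃ, x₄ ↦ i·(zᵇ·w̄ᵃ − z̄ᵇ·wᵃ) intertwines brackets: F({f, g}) = {F f, F g}₀, where {p, q}₀ := −2i·(∂p/∂z·∂q/∂z̄ − ∂p/∂z̄·∂q/∂z + ∂p/∂w·∂q/∂w̄ − ∂p/∂w̄·∂q/∂w). (This realizes the (a,b)-resonance space ℂ²/S¹ as a Poisson subvariety of 4-space.) -/
open MvPolynomial

/-- The bracket on ℂ[x₁, x₂, x₃, x₄] with structure functions `{x₁,x₂} = 0`,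
`{x₁,x₃} = 2b x₄`, `{x₁,x₄} = −2b x₃`, `{x₂,x₃} = −2a x₄`, `{x₂,x₄} = 2a x₃`,
`{x₃,x₄} = 4 x₁^{b−1} x₂^{a−1} (a² x₁ − b² x₂)` (variables indexed `i ↦ x_{i+1}`). -/
noncomputable def resBr (a b : ℕ) (f g : MvPolynomial (Fin 4) ℂ) : MvPolynomial (Fin 4) ℂ :=
  (C (2 * (b : ℂ)) * X 3) * (pderiv 0 f * pderiv 2 g - pderiv 2 f * pderiv 0 g) +
  (C (-(2 * (b : ℂ))) * X 2) * (pderiv 0 f * pderiv 3 g - pderiv 3 f * pderiv 0 g) +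
  (C (-(2 * (a : ℂ))) * X 3) * (pderiv 1 f * pderiv 2 g - pderiv 2 f * pderiv 1 g) +
  (C (2 * (a : ℂ)) * X 2) * (pderiv 1 f * pderiv 3 g - pderiv 3 f * pderiv 1 g) +
  (C (4 : ℂ) * X 0 ^ (b - 1) * X 1 ^ (a - 1) *
      (C ((a : ℂ) ^ 2) * X 0 - C ((b : ℂ) ^ 2) * X 1)) *
    (pderiv 2 f * pderiv 3 g - pderiv 3 f * pderiv 2 g)

/-- The bracket `{p,q}₀ = −2i(p_z q_z̄ − p_z̄ q_z + p_w q_w̄ − p_w̄ q_w)` on ℂ[z, z̄, w, w̄]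
(variables indexed `0 ↦ z, 1 ↦ z̄, 2 ↦ w, 3 ↦ w̄`). -/
noncomputable def kahlerBr4 (p q : MvPolynomial (Fin 4) ℂ) : MvPolynomial (Fin 4) ℂ :=
  C (-(2 * Complex.I)) *
    (pderiv 0 p * pderiv 1 q - pderiv 1 p * pderiv 0 q +
      pderiv 2 p * pderiv 3 q - pderiv 3 p * pderiv 2 q)

/-- The Hilbert-map pullback `x₁ ↦ z z̄, x₂ ↦ w w̄, x₃ ↦ zᵇ w̄ᵃ + z̄ᵇ wᵃ,
x₄ ↦ i(zᵇ w̄ᵃ − z̄ᵇ wᵃ)`. -/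
noncomputable def resHilbert (a b : ℕ) : MvPolynomial (Fin 4) ℂ →ₐ[ℂ] MvPolynomial (Fin 4) ℂ :=
  aeval ![X 0 * X 1, X 2 * X 3,
    X 0 ^ b * X 3 ^ a + X 1 ^ b * X 2 ^ a,
    C Complex.I * (X 0 ^ b * X 3 ^ a - X 1 ^ b * X 2 ^ a)]

namespace MvPolynomial

theorem pderiv_comm {R σ : Type*} [CommRing R] (i j : σ) (p : MvPolynomial σ R) :
    pderiv i (pderiv j p) = pderiv j (pderiv i p) := by
  have h : ⁅pderiv (R := R) i, pderiv (R := R) j⁆ = 0 := by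
    refine derivation_ext fun k => ?_
    classical
    rw [Derivation.commutator_apply]
    simp only [pderiv_X, Pi.single_apply]
    split_ifs <;> simp
  have := DFunLike.congr_fun h p
  rwa [Derivation.commutator_apply, Derivation.zero_apply, sub_eq_zero] at this

/-- The chain rule for a partial derivative of a polynomial substitution. -/
theorem pderiv_aeval_s16 {R σ τ : Type*} [CommSemiring R] [Fintype σ] (φ : σ → MvPolynomial τ R)
    (k : τ) (p : MvPolynomial σ R) :
    pderiv k (aeval φ p) = ∑ i, aeval φ (pderiv i p) * pderiv k (φ i) := by
  classical
  induction p using MvPolynomial.induction_on with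
  | C r => simp [← algebraMap_eq]
  | add p q hp hq => simp only [map_add, hp, hq, add_mul, Finset.sum_add_distrib]
  | mul_X p j hp =>
    simp only [map_mul, aeval_X, Derivation.leibniz, smul_eq_mul, hp, pderiv_X, map_add,
      add_mul, Finset.sum_add_distrib, Finset.mul_sum, Pi.single_apply]
    congr 1
    · simp [apply_ite, ite_mul]
    · exact Finset.sum_congr rfl fun i _ => by ring

end MvPolynomial

theorem resBr_jacobi (a b : ℕ) (f g h : MvPolynomial (Fin 4) ℂ) :
    resBr a b f (resBr a b g h) + resBr a b g (resBr a b h f) +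
      resBr a b h (resBr a b f g) = 0 := by
  obtain ⟨P, hP⟩ : ∃ P : MvPolynomial (Fin 4) ℂ, P = C (4 : ℂ) * X 0 ^ (b - 1) * X 1 ^ (a - 1) *
      (C ((a : ℂ) ^ 2) * X 0 - C ((b : ℂ) ^ 2) * X 1) := ⟨_, rfl⟩
  have hP2 : pderiv 2 P = 0 := by
    simp [hP, Derivation.leibniz, Derivation.leibniz_pow, pderiv_X]
  have hP3 : pderiv 3 P = 0 := by
    simp [hP, Derivation.leibniz, Derivation.leibniz_pow, pderiv_X]
  unfold resBr
  simp only [← hP, C_neg]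
  have h10 := pderiv_comm (R := ℂ) (1 : Fin 4) 0
  have h20 := pderiv_comm (R := ℂ) (2 : Fin 4) 0
  have h30 := pderiv_comm (R := ℂ) (3 : Fin 4) 0
  have h21 := pderiv_comm (R := ℂ) (2 : Fin 4) 1
  have h31 := pderiv_comm (R := ℂ) (3 : Fin 4) 1
  have h32 := pderiv_comm (R := ℂ) (3 : Fin 4) 2
  simp only [map_add, map_sub, map_neg, Derivation.leibniz, smul_eq_mul, pderiv_C, hP2, hP3,
    h10, h20, h30, h21, h31, h32, pderiv_X, Pi.single_apply, Fin.reduceEq, if_true, if_false]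
  ring

theorem resHilbert_resBr (a b : ℕ) (ha : 1 ≤ a) (hb : 1 ≤ b) (f g : MvPolynomial (Fin 4) ℂ) :
    resHilbert a b (resBr a b f g) = kahlerBr4 (resHilbert a b f) (resHilbert a b g) := by
  obtain ⟨m, rfl⟩ := Nat.exists_eq_add_of_le' ha
  obtain ⟨n, rfl⟩ := Nat.exists_eq_add_of_le' hb
  have hI : (C Complex.I : MvPolynomial (Fin 4) ℂ) ^ 2 = -1 := by
    rw [← C_pow, Complex.I_sq, C_neg, C_1]
  unfold resBr kahlerBr4 resHilbert
  simp only [pderiv_aeval_s16, Fin.sum_univ_four, map_add, map_mul, map_sub, map_pow, aeval_X,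
    aeval_C, algebraMap_eq]
  generalize (aeval _ : MvPolynomial (Fin 4) ℂ →ₐ[ℂ] MvPolynomial (Fin 4) ℂ) = F
  simp only [Matrix.cons_val, map_add, map_sub, Derivation.leibniz, Derivation.leibniz_pow,
    pderiv_C, pderiv_X, Pi.single_apply, Fin.reduceEq, if_true, if_false, smul_eq_mul,
    nsmul_eq_mul, C_neg, C_mul, map_natCast, map_ofNat, Nat.add_sub_cancel]
  push_cast
  linear_combination
    (2 * (X 0 ^ (n + 1) * X 3 ^ (m + 1) + X 1 ^ (n + 1) * X 2 ^ (m + 1)) *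
        ((m + 1) * (F (pderiv 1 f) * F (pderiv 3 g) - F (pderiv 3 f) * F (pderiv 1 g)) -
          (n + 1) * (F (pderiv 0 f) * F (pderiv 3 g) - F (pderiv 3 f) * F (pderiv 0 g))) +
      4 * (X 0 * X 1) ^ n * (X 2 * X 3) ^ m *
        ((m + 1) ^ 2 * (X 0 * X 1) - (n + 1) ^ 2 * (X 2 * X 3)) *
        (F (pderiv 2 f) * F (pderiv 3 g) - F (pderiv 3 f) * F (pderiv 2 g))) * hI

/-- (a) The bracket `resBr a b` satisfies the Jacobi identity, and (b) the Hilbert map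
intertwines it with the Kähler bracket `{·,·}₀`: this realizes the (a,b)-resonance space
ℂ²/S¹ as a Poisson subvariety of 4-space. -/
theorem resonance_poisson_embedding (a b : ℕ) (ha : 1 ≤ a) (hb : 1 ≤ b) :
    (∀ f g h : MvPolynomial (Fin 4) ℂ,
      resBr a b f (resBr a b g h) + resBr a b g (resBr a b h f) +
        resBr a b h (resBr a b f g) = 0) ∧
    (∀ f g : MvPolynomial (Fin 4) ℂ,
      resHilbert a b (resBr a b f g) = kahlerBr4 (resHilbert a b f) (resHilbert a b g)) := by
  exact ⟨resBr_jacobi a b, resHilbert_resBr a b ha hb⟩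
end

section
/- Let n ≥ 3 be an odd integer, let ζ ∈ ℂ be a primitive n-th root of unity, and let R_n ⊆ ℂ[z, z̄, w, w̄] be the invariant subalgebra of the automorphism g_ζ (z ↦ ζz, z̄ ↦ ζ⁻¹z̄, w ↦ ζw, w̄ ↦ ζ⁻¹w̄). R_n is closed under the standard symplectic bracket {p, q} := p_z q_{z̄} − p_{z̄} q_z + p_w q_{w̄} − p_{w̄} q_w. Then there do NOT exist a ℂ-bilinear Poisson bracket B on the polynomial ring ℂ[u₁, …, u_{2n+6}] in 2n + 6 variables together with a surjective ℂ-algebra homomorphism φ : ℂ[u₁, …, u_{2n+6}] → R_n such that φ(B f g) = {φ f, φ g} for all f, g. (This is the algebraic form of the paper's main nonembedding theorem: although the symplectic quotient V/ℤ_n embeds into 2n+6-dimensional affine space, it is not realizable there as a Poisson subvariety for any Poisson structure.) -/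
open MvPolynomial

/-- A ℂ-bilinear Poisson bracket on a commutative ℂ-algebra: additive and ℂ-homogeneous in
each argument, antisymmetric, satisfying the Jacobi identity and the Leibniz rule. -/
def IsPoissonBracketC {A : Type*} [CommRing A] [Algebra ℂ A] (B : A → A → A) : Prop :=
  (∀ f g h : A, B (f + g) h = B f h + B g h) ∧
  (∀ f g h : A, B f (g + h) = B f g + B f h) ∧
  (∀ (c : ℂ) (f g : A), B (c • f) g = c • B f g) ∧
  (∀ (c : ℂ) (f g : A), B f (c • g) = c • B f g) ∧
  (∀ f g : A, B f g = - B g f) ∧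
  (∀ f g h : A, B f (B g h) + B g (B h f) + B h (B f g) = 0) ∧
  (∀ f g h : A, B (f * g) h = f * B g h + g * B f h)

/-- The standard symplectic bracket `{p, q} = p_z q_z̄ − p_z̄ q_z + p_w q_w̄ − p_w̄ q_w`
on ℂ[z, z̄, w, w̄]. -/
noncomputable def sympBr (p q : MvPolynomial (Fin 4) ℂ) : MvPolynomial (Fin 4) ℂ :=
  pderiv 0 p * pderiv 1 q - pderiv 1 p * pderiv 0 q +
    pderiv 2 p * pderiv 3 q - pderiv 3 p * pderiv 2 q

namespace Nonembedding

section Ideal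

variable {σ : Type*}

lemma pderiv_mem_pow_idealOfVars {p : MvPolynomial σ ℂ} {k : ℕ}
    (hp : p ∈ idealOfVars σ ℂ ^ (k + 1)) (i : σ) : pderiv i p ∈ idealOfVars σ ℂ ^ k := by
  rw [mem_pow_idealOfVars_iff'] at hp ⊢
  intro x hx
  rw [coeff_pderiv, hp, zero_mul]
  simpa using hx

lemma mem_pow_succ_idealOfVars_of_pderiv {p : MvPolynomial σ ℂ} {k : ℕ}
    (h0 : coeff 0 p = 0) (hp : ∀ i, pderiv i p ∈ idealOfVars σ ℂ ^ k) :
    p ∈ idealOfVars σ ℂ ^ (k + 1) := by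
  rw [mem_pow_idealOfVars_iff']
  intro x hx
  by_cases hx0 : x = 0
  · rw [hx0, h0]
  obtain ⟨i, hi⟩ := Finsupp.ne_iff.mp hx0
  have hxi : x - Finsupp.single i 1 + Finsupp.single i 1 = x :=
    tsub_add_cancel_of_le (Finsupp.single_le_iff.mpr (Nat.one_le_iff_ne_zero.mpr hi))
  have h := (mem_pow_idealOfVars_iff' _ _).mp (hp i) (x - Finsupp.single i 1) (by
    rw [← hxi] at hx
    simpa using hx)
  rw [coeff_pderiv, hxi] at h
  exact (mul_eq_zero.mp h).resolve_right (Nat.cast_add_one_ne_zero _)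

lemma mem_idealOfVars_iff {p : MvPolynomial σ ℂ} : p ∈ idealOfVars σ ℂ ↔ coeff 0 p = 0 := by
  rw [← pow_one (idealOfVars σ ℂ), mem_pow_idealOfVars_iff']
  refine ⟨fun h => h 0 (by simp), fun h x hx => ?_⟩
  rwa [(Finsupp.degree_eq_zero_iff x).mp (Nat.lt_one_iff.mp hx)]

lemma map_mem_pow_idealOfVars {τ : Type*} (ψ : MvPolynomial σ ℂ →ₐ[ℂ] MvPolynomial τ ℂ)
    (hψ : ∀ s, ψ (X s) ∈ idealOfVars τ ℂ) {p : MvPolynomial σ ℂ} {k : ℕ}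
    (hp : p ∈ idealOfVars σ ℂ ^ k) : ψ p ∈ idealOfVars τ ℂ ^ k := by
  have h : (idealOfVars σ ℂ).map ψ ≤ idealOfVars τ ℂ := by
    rw [Ideal.map_span, Ideal.span_le]
    rintro _ ⟨_, ⟨s, rfl⟩, rfl⟩
    exact hψ s
  exact Ideal.pow_right_mono h k (Ideal.map_pow ψ _ k ▸ Ideal.mem_map_of_mem _ hp)

end Ideal

section Restriction

variable {σ τ : Type*}

/-- Setting the second group of variables to zero. -/
noncomputable def restrictVars : MvPolynomial (σ ⊕ τ) ℂ →ₐ[ℂ] MvPolynomial σ ℂ :=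
  aeval (Sum.elim X (C ∘ 0))

lemma restrictVars_pderiv (p : MvPolynomial (σ ⊕ τ) ℂ) (l : σ) :
    restrictVars (pderiv (Sum.inl l) p) = pderiv l (restrictVars p) :=
  aeval_sumElim_pderiv_inl p 0 l

lemma restrictVars_eq_zero {w : σ ⊕ τ → ℤ} (hw : ∀ l, w (Sum.inl l) = 0)
    {p : MvPolynomial (σ ⊕ τ) ℂ} {c : ℤ} (hp : p.IsWeightedHomogeneous w c) (hc : c ≠ 0) :
    restrictVars p = 0 := by
  induction hp using IsWeightedHomogeneous.induction_on with
  | zero => simp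
  | add p q _ _ hp hq => rw [map_add, hp, hq, add_zero]
  | monomial d r hr =>
    have : ∃ t, d (Sum.inr t) ≠ 0 := by
      by_contra! h
      apply hc
      rw [← hr, Finsupp.weight_apply]
      refine Finset.sum_eq_zero fun s _ => ?_
      rcases s with l | t
      · simp [hw]
      · simp [h]
    obtain ⟨t, ht⟩ := this
    rw [restrictVars, aeval_monomial]
    refine mul_eq_zero_of_right _ (Finset.prod_eq_zero (i := Sum.inr t) (by simpa using ht) ?_)
    simp [ht]

lemma restrictVars_mem_pow {p : MvPolynomial (σ ⊕ τ) ℂ} {k : ℕ}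
    (hp : p ∈ idealOfVars (σ ⊕ τ) ℂ ^ k) : restrictVars p ∈ idealOfVars σ ℂ ^ k := by
  refine map_mem_pow_idealOfVars _ (fun s => ?_) hp
  rcases s with l | t
  · simpa [restrictVars] using Ideal.subset_span (Set.mem_range_self l)
  · simp [restrictVars]

lemma coeff_restrictVars (d : σ →₀ ℕ) (p : MvPolynomial (σ ⊕ τ) ℂ) :
    coeff d (restrictVars p) = coeff (d.mapDomain Sum.inl) p := by
  classical
  induction p using MvPolynomial.induction_on' with
  | add p q hp hq => simp [hp, hq]
  | monomial e r =>
    by_cases h : ∃ t, e (Sum.inr t) ≠ 0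
    · obtain ⟨t, ht⟩ := h
      rw [restrictVars, aeval_monomial,
        Finsupp.prod, Finset.prod_eq_zero (i := Sum.inr t) (by simpa using ht) (by simp [ht]),
        mul_zero, coeff_zero, coeff_monomial, if_neg]
      rintro rfl
      exact ht (Finsupp.mapDomain_of_notMem_range _ _ (by simp))
    · push Not at h
      have he : e = (e.comapDomain Sum.inl Sum.inl_injective.injOn).mapDomain Sum.inl := by
        ext s
        rcases s with l | t
        · rw [Finsupp.mapDomain_apply Sum.inl_injective, Finsupp.comapDomain_apply]
        · rw [h, Finsupp.mapDomain_of_notMem_range _ _ (by simp)]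
      rw [he]
      generalize e.comapDomain Sum.inl Sum.inl_injective.injOn = e'
      have : restrictVars (monomial (e'.mapDomain (Sum.inl : σ → σ ⊕ τ)) r) = monomial e' r := by
        rw [restrictVars, aeval_monomial, Finsupp.prod_mapDomain_index_inj Sum.inl_injective,
          monomial_eq]
        simp
      rw [this, coeff_monomial, coeff_monomial]
      simp [(Finsupp.mapDomain_injective Sum.inl_injective).eq_iff]

end Restriction

section Rigidity

/-- The coefficient of `z^(n-m) w^m` in the bracket of `z^(n-i) w^i` with the `l`-th of
`z z̄, z w̄, w z̄, w w̄`. -/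
def structConst (n i : ℕ) (l : Fin 4) (m : ℕ) : ℂ :=
  ![if m = i then (n : ℂ) - i else 0, if m + 1 = i then (i : ℂ) else 0,
    if m = i + 1 then (n : ℂ) - i else 0, if m = i then (i : ℂ) else 0] l

lemma eq_zero_of_structConst_symm {V : Type*} [AddCommGroup V] [Module ℂ V] {n : ℕ} (hn : 3 ≤ n)
    (F : ℕ → Fin 4 → V)
    (hF : ∀ i ≤ n, ∀ j ≤ n, ∀ m ≤ n,
      ∑ l, structConst n i l m • F j l = ∑ l, structConst n j l m • F i l) :
    ∀ j ≤ n, ∀ l, F j l = 0 := by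
  simp only [structConst, Fin.sum_univ_four, Matrix.cons_val_zero, Matrix.cons_val_one,
    Matrix.cons_val] at hF
  have hn0 : (n : ℂ) ≠ 0 := by norm_cast; omega
  have hn2 : (n : ℂ) - 2 ≠ 0 := by
    rw [sub_ne_zero]; norm_cast; omega
  have h01 : F 0 1 = 0 := by
    simpa using hF 3 (by omega) 0 (by omega) 2 (by omega)
  have h02 : F 0 2 = 0 := by
    simpa [hn2] using hF 2 (by omega) 0 (by omega) 3 (by omega)
  have h2 : ((n : ℂ) - 2) • F 0 0 + (2 : ℂ) • F 0 3 = 0 := by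
    simpa using hF 2 (by omega) 0 (by omega) 2 (by omega)
  have h3 : ((n : ℂ) - 3) • F 0 0 + (3 : ℂ) • F 0 3 = 0 := by
    simpa using hF 3 (by omega) 0 (by omega) 3 (by omega)
  have h00 : F 0 0 = 0 := by
    have : (n : ℂ) • F 0 0 = 0 := by
      calc (n : ℂ) • F 0 0 = (3 : ℂ) • (((n : ℂ) - 2) • F 0 0 + (2 : ℂ) • F 0 3) -
            (2 : ℂ) • (((n : ℂ) - 3) • F 0 0 + (3 : ℂ) • F 0 3) := by module
        _ = 0 := by rw [h2, h3, smul_zero, smul_zero, sub_zero]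
    exact (smul_eq_zero.mp this).resolve_left hn0
  have h03 : F 0 3 = 0 := by simpa [h00] using h3
  have hx : ∀ j ≤ n, F j 0 = 0 := fun j hj => by
    have := hF 0 (by omega) j hj 0 (by omega)
    simpa [h00, h01, h02, h03, hn0] using this
  have hu : ∀ j ≤ n, F j 2 = 0 := fun j hj => by
    have := hF 0 (by omega) j hj 1 (by omega)
    simpa [h00, h01, h02, h03, hn0] using this
  have hn3 : F n 3 = 0 := by
    have := hF 1 (by omega) n le_rfl 1 (by omega)
    rw [hx _ le_rfl, hu _ le_rfl, hx _ (by omega), hu _ (by omega)] at this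
    simpa [show 1 ≠ n by omega, show 2 ≠ n by omega] using this
  have hn1 : F n 1 = 0 := by
    have := hF 1 (by omega) n le_rfl 0 (by omega)
    rw [hx _ le_rfl, hu _ le_rfl, hx _ (by omega), hu _ (by omega)] at this
    simpa [show 1 ≠ n by omega, show 0 ≠ n by omega] using this
  intro j hj l
  have hv : F j 3 = 0 := by
    have := hF n le_rfl j hj n le_rfl
    simpa [hx n le_rfl, hu n le_rfl, hn1, hn3, hx j hj, hu j hj, hn0] using this
  have hy : F j 1 = 0 := by
    have := hF n le_rfl j hj (n - 1) (by omega)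
    rw [hx _ le_rfl, hu _ le_rfl, hn1, hn3, hx j hj, hu j hj, hv] at this
    simpa [show n - 1 + 1 = n by omega, hn0] using this
  fin_cases l
  exacts [hx j hj, hy, hu j hj, hv]

end Rigidity

section Generators

/-- Index set of the generators of `R_n`: the four quadratic invariants, the `n + 1` holomorphic
ones and the `n + 1` antiholomorphic ones. -/
abbrev GenIdx (n : ℕ) : Type := Fin 4 ⊕ (Fin (n + 1) ⊕ Fin (n + 1))

/-- The holomorphic degree minus the antiholomorphic degree of a generator, divided by `n`. -/
def charge (n : ℕ) : GenIdx n → ℤ := Sum.elim 0 (Sum.elim 1 (-1))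

/-- Exponents of the generators of `R_n`: the quadratic ones `z z̄, z w̄, w z̄, w w̄`, then
`z^(n-i) w^i` and `z̄^(n-k) w̄^k`. -/
noncomputable def genExp (n : ℕ) : GenIdx n → (Fin 4 →₀ ℕ)
  | Sum.inl l => Finsupp.equivFunOnFinite.symm
      (![![1, 1, 0, 0], ![1, 0, 0, 1], ![0, 1, 1, 0], ![0, 0, 1, 1]] l)
  | Sum.inr (Sum.inl i) => Finsupp.equivFunOnFinite.symm ![n - i, 0, i, 0]
  | Sum.inr (Sum.inr k) => Finsupp.equivFunOnFinite.symm ![0, n - k, 0, k]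

/-- The monomial generators of `R_n`. -/
noncomputable def gen (n : ℕ) (s : GenIdx n) : MvPolynomial (Fin 4) ℂ := monomial (genExp n s) 1

/-- The exponent obtained by substituting the generators into a monomial. -/
noncomputable def totalExp (n : ℕ) (d : GenIdx n →₀ ℕ) : Fin 4 →₀ ℕ := ∑ s, d s • genExp n s

lemma aeval_gen_monomial (n : ℕ) (d : GenIdx n →₀ ℕ) (r : ℂ) :
    aeval (gen n) (monomial d r) = monomial (totalExp n d) r := by
  have h : (d.prod fun s k => gen n s ^ k) = monomial (totalExp n d) 1 := by
    rw [Finsupp.prod_fintype _ _ (by simp), totalExp, monomial_sum_one]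
    exact Finset.prod_congr rfl fun s _ => by rw [gen, monomial_pow, one_pow]
  rw [aeval_monomial, h, algebraMap_eq, C_mul_monomial, mul_one]

lemma coeff_aeval_gen {n : ℕ} {d : GenIdx n →₀ ℕ}
    (hd : ∀ e, totalExp n e = totalExp n d → e = d) (p : MvPolynomial (GenIdx n) ℂ) :
    coeff (totalExp n d) (aeval (gen n) p) = coeff d p := by
  classical
  induction p using MvPolynomial.induction_on' with
  | add p q hp hq => rw [map_add, coeff_add, coeff_add, hp, hq]
  | monomial e r =>
    rw [aeval_gen_monomial, coeff_monomial, coeff_monomial]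
    exact if_congr ⟨hd e, fun h => by rw [h]⟩ rfl rfl

lemma totalExp_apply (n : ℕ) (d : GenIdx n →₀ ℕ) (c : Fin 4) :
    totalExp n d c = ∑ l, d (Sum.inl l) * genExp n (Sum.inl l) c +
      (∑ i, d (Sum.inr (Sum.inl i)) * genExp n (Sum.inr (Sum.inl i)) c +
        ∑ k, d (Sum.inr (Sum.inr k)) * genExp n (Sum.inr (Sum.inr k)) c) := by
  simp [totalExp]

lemma totalExp_hol (n : ℕ) (d : GenIdx n →₀ ℕ) :
    totalExp n d 0 + totalExp n d 2 =
      ∑ l, d (Sum.inl l) + n * ∑ i, d (Sum.inr (Sum.inl i)) := by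
  have h : ∀ i : Fin (n + 1), d (Sum.inr (Sum.inl i)) * (n - i) + d (Sum.inr (Sum.inl i)) * i =
      n * d (Sum.inr (Sum.inl i)) := fun i => by
    rw [← mul_add, Nat.sub_add_cancel (Nat.lt_succ_iff.mp i.isLt), mul_comm]
  simp only [totalExp_apply, genExp, Fin.sum_univ_four, Finsupp.equivFunOnFinite_symm_apply_apply]
  rw [Finset.mul_sum, ← Finset.sum_congr rfl fun i _ => h i, Finset.sum_add_distrib]
  simp
  ring

lemma totalExp_antihol (n : ℕ) (d : GenIdx n →₀ ℕ) :
    totalExp n d 1 + totalExp n d 3 =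
      ∑ l, d (Sum.inl l) + n * ∑ k, d (Sum.inr (Sum.inr k)) := by
  have h : ∀ k : Fin (n + 1), d (Sum.inr (Sum.inr k)) * (n - k) + d (Sum.inr (Sum.inr k)) * k =
      n * d (Sum.inr (Sum.inr k)) := fun k => by
    rw [← mul_add, Nat.sub_add_cancel (Nat.lt_succ_iff.mp k.isLt), mul_comm]
  simp only [totalExp_apply, genExp, Fin.sum_univ_four, Finsupp.equivFunOnFinite_symm_apply_apply]
  rw [Finset.mul_sum, ← Finset.sum_congr rfl fun k _ => h k, Finset.sum_add_distrib]
  simp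
  ring

lemma totalExp_single (n : ℕ) (s : GenIdx n) : totalExp n (Finsupp.single s 1) = genExp n s := by
  classical
  rw [totalExp, Finset.sum_eq_single s]
  · simp
  · intro t _ ht
    simp [ht.symm]
  · simp

lemma eq_zero_of_totalExp {n : ℕ} (hn : 0 < n) (e : GenIdx n →₀ ℕ)
    (h : totalExp n e = totalExp n 0) : e = 0 := by
  have h0 : totalExp n 0 = 0 := by simp [totalExp]
  have h1 := totalExp_hol n e
  have h2 := totalExp_antihol n e
  rw [h, h0] at h1 h2
  simp only [Finsupp.coe_zero, Pi.zero_apply, add_zero] at h1 h2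
  have h3 := h1.symm
  have h4 := h2.symm
  simp only [Nat.add_eq_zero_iff, mul_eq_zero, hn.ne', false_or, Finset.sum_eq_zero_iff,
    Finset.mem_univ, true_implies] at h3 h4
  ext s
  rcases s with l | i | k
  exacts [h3.1 l, h3.2 i, h4.2 k]

lemma eq_single_of_totalExp_hol {n : ℕ} (hn : 0 < n) (m : Fin (n + 1)) (e : GenIdx n →₀ ℕ)
    (h : totalExp n e = totalExp n (Finsupp.single (Sum.inr (Sum.inl m)) 1)) :
    e = Finsupp.single (Sum.inr (Sum.inl m)) 1 := by
  rw [totalExp_single] at h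
  have h1 := totalExp_hol n e
  have h2 := totalExp_antihol n e
  rw [h] at h1 h2
  simp only [genExp, Finsupp.equivFunOnFinite_symm_apply_apply, Matrix.cons_val] at h1 h2
  have h4 := h2.symm
  simp only [add_zero, Nat.add_eq_zero_iff, mul_eq_zero, hn.ne', false_or, Finset.sum_eq_zero_iff,
    Finset.mem_univ, true_implies] at h4
  have hx : ∑ l, e (Sum.inl l) = 0 := Finset.sum_eq_zero fun l _ => h4.1 l
  rw [hx, Nat.sub_add_cancel (Nat.lt_succ_iff.mp m.isLt), zero_add] at h1
  have ha : ∑ i, e (Sum.inr (Sum.inl i)) = 1 := by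
    apply Nat.eq_of_mul_eq_mul_left hn
    rw [← h1, mul_one]
  obtain ⟨j, -, hj⟩ : ∃ j ∈ Finset.univ, e (Sum.inr (Sum.inl j)) ≠ 0 :=
    Finset.exists_ne_zero_of_sum_ne_zero (by rw [ha]; exact one_ne_zero)
  rw [← Finset.add_sum_erase _ _ (Finset.mem_univ j)] at ha
  have hj1 : e (Sum.inr (Sum.inl j)) = 1 := by omega
  have hrest : ∑ i ∈ Finset.univ.erase j, e (Sum.inr (Sum.inl i)) = 0 := by omega
  rw [Finset.sum_eq_zero_iff] at hrest
  have he : e = Finsupp.single (Sum.inr (Sum.inl j)) 1 := by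
    ext s
    rcases s with l | i | k
    · simp [h4.1 l]
    · by_cases hij : i = j
      · simp [hij, hj1]
      · rw [hrest i (by simp [hij])]
        simp [Ne.symm hij]
    · simp [h4.2 k]
  rw [he, totalExp_single] at h
  have := DFunLike.congr_fun h 2
  simp only [genExp, Finsupp.equivFunOnFinite_symm_apply_apply, Matrix.cons_val] at this
  rw [he, Fin.ext this]

lemma totalExp_single_quadratic (n k : ℕ) (c : Fin 4) :
    totalExp n (Finsupp.single (Sum.inl 0) k) c = ![k, k, 0, 0] c := by
  rw [totalExp_apply]
  fin_cases c <;> simp [genExp, Finsupp.single_apply]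

lemma eq_single_of_totalExp_quadratic {n : ℕ} (hn : 0 < n) (e : GenIdx n →₀ ℕ)
    (h : totalExp n e = totalExp n (Finsupp.single (Sum.inl 0) (n - 1))) :
    e = Finsupp.single (Sum.inl 0) (n - 1) := by
  have ht := totalExp_single_quadratic n (n - 1)
  have h1 := totalExp_hol n e
  have h2 := totalExp_antihol n e
  have h3 := totalExp_apply n e 2
  have h4 := totalExp_apply n e 3
  rw [h, ht, ht] at h1 h2
  rw [h, ht] at h3 h4
  simp only [genExp, Finsupp.equivFunOnFinite_symm_apply_apply, Matrix.cons_val,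
    Fin.sum_univ_four] at h1 h2 h3 h4
  have ha : ∑ i, e (Sum.inr (Sum.inl i)) = 0 := by
    by_contra h0
    have := Nat.le_mul_of_pos_right n (Nat.pos_of_ne_zero h0)
    omega
  have hb : ∑ k, e (Sum.inr (Sum.inr k)) = 0 := by
    by_contra h0
    have := Nat.le_mul_of_pos_right n (Nat.pos_of_ne_zero h0)
    omega
  rw [ha] at h1
  rw [Finset.sum_eq_zero_iff] at ha hb
  have hx : e (Sum.inl 0) = n - 1 ∧ e (Sum.inl 1) = 0 ∧ e (Sum.inl 2) = 0 ∧
      e (Sum.inl 3) = 0 := by omega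
  ext s
  rcases s with l | i | k
  · fin_cases l <;> simp [hx]
  · simp [ha i]
  · simp [hb k]

lemma coeff_pderiv_mul_pderiv (s t μ : Fin 4 →₀ ℕ) (i j : Fin 4) :
    coeff μ (pderiv i (monomial s (1 : ℂ)) * pderiv j (monomial t 1)) =
      if s + t = μ + (Finsupp.single i 1 + Finsupp.single j 1) then (s i : ℂ) * t j else 0 := by
  classical
  rw [pderiv_monomial, pderiv_monomial, monomial_mul, coeff_monomial, one_mul, one_mul]
  by_cases hs : s i = 0
  · simp [hs]
  by_cases ht : t j = 0
  · simp [ht]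
  refine if_congr ?_ rfl rfl
  obtain ⟨s', rfl⟩ := exists_add_of_le (Finsupp.single_le_iff.mpr (Nat.one_le_iff_ne_zero.mpr hs))
  obtain ⟨t', rfl⟩ := exists_add_of_le (Finsupp.single_le_iff.mpr (Nat.one_le_iff_ne_zero.mpr ht))
  rw [add_tsub_cancel_left, add_tsub_cancel_left, add_add_add_comm, add_comm μ, add_right_inj]

lemma coeff_sympBr_monomial (s t μ : Fin 4 →₀ ℕ) :
    coeff μ (sympBr (monomial s 1) (monomial t 1)) =
      (if s + t = μ + (Finsupp.single 0 1 + Finsupp.single 1 1) then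
        (s 0 : ℂ) * t 1 - s 1 * t 0 else 0) +
      if s + t = μ + (Finsupp.single 2 1 + Finsupp.single 3 1) then
        (s 2 : ℂ) * t 3 - s 3 * t 2 else 0 := by
  rw [sympBr, coeff_sub, coeff_add, coeff_sub]
  simp only [coeff_pderiv_mul_pderiv, add_comm (Finsupp.single (1 : Fin 4) 1) (Finsupp.single 0 1),
    add_comm (Finsupp.single (3 : Fin 4) 1) (Finsupp.single 2 1)]
  split_ifs <;> ring

lemma coeff_sympBr_hol_quadratic {n : ℕ} (i m : Fin (n + 1)) (l : Fin 4) :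
    coeff (genExp n (Sum.inr (Sum.inl m)))
      (sympBr (gen n (Sum.inr (Sum.inl i))) (gen n (Sum.inl l))) = structConst n i l m := by
  have hi := i.isLt
  have hm := m.isLt
  have hc : ((n - i : ℕ) : ℂ) = n - i := Nat.cast_sub (by omega)
  rw [gen, gen, coeff_sympBr_monomial]
  fin_cases l <;>
    simp [genExp, structConst, Finsupp.ext_iff, Fin.forall_fin_succ, hc]
  all_goals exact if_congr (by omega) rfl rfl

lemma coeff_sympBr_hol_antihol {n : ℕ} (hn : 0 < n) :
    coeff (totalExp n (Finsupp.single (Sum.inl 0) (n - 1)))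
      (sympBr (gen n (Sum.inr (Sum.inl 0))) (gen n (Sum.inr (Sum.inr 0)))) = (n : ℂ) ^ 2 := by
  rw [gen, gen, coeff_sympBr_monomial]
  have ht := totalExp_single_quadratic n (n - 1)
  generalize totalExp n (Finsupp.single (Sum.inl 0) (n - 1)) = μ at ht ⊢
  simp only [Finsupp.ext_iff, Fin.forall_fin_succ, Finsupp.add_apply, ht]
  simp [genExp, Nat.sub_add_cancel hn, sq]

lemma coeff_zero_sympBr_hol_antihol {n : ℕ} (hn : 3 ≤ n) (j k : Fin (n + 1)) :
    coeff 0 (sympBr (gen n (Sum.inr (Sum.inl j))) (gen n (Sum.inr (Sum.inr k)))) = 0 := by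
  rw [gen, gen, coeff_sympBr_monomial]
  rw [if_neg, if_neg, add_zero] <;> intro h <;>
    have h0 := DFunLike.congr_fun h 0 <;> have h2 := DFunLike.congr_fun h 2 <;>
    simp [genExp, -Fin.val_eq_zero_iff] at h0 h2 <;> omega

end Generators

section Endgame

variable {n : ℕ}

/-- The coefficient of a holomorphic variable, up to first order in the non-quadratic variables. -/
noncomputable def holCoeff (m : Fin (n + 1)) (p : MvPolynomial (GenIdx n) ℂ) :
    MvPolynomial (Fin 4) ℂ :=
  restrictVars (pderiv (Sum.inr (Sum.inl m)) p)

lemma holCoeff_pderiv_mul (m : Fin (n + 1)) (s : GenIdx n) (p q : MvPolynomial (GenIdx n) ℂ) :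
    holCoeff m (pderiv s p * q) =
      restrictVars (pderiv s p) * holCoeff m q + holCoeff m (pderiv s p) * restrictVars q := by
  simp only [holCoeff, pderiv_mul, map_add, map_mul]
  ring

lemma restrictVars_eq_zero_of_charge {p : MvPolynomial (GenIdx n) ℂ} {c : ℤ}
    (hp : p.IsWeightedHomogeneous (charge n) c) (hc : c ≠ 0) : restrictVars p = 0 :=
  restrictVars_eq_zero (fun _ => rfl) hp hc

lemma holCoeff_eq_zero_of_charge {p : MvPolynomial (GenIdx n) ℂ} {c : ℤ} (m : Fin (n + 1))
    (hp : p.IsWeightedHomogeneous (charge n) c) (hc : c ≠ 1) : holCoeff m p = 0 :=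
  restrictVars_eq_zero_of_charge (hp.pderiv (n' := c - 1) (by simp [charge]))
    (sub_ne_zero.mpr hc)

/-- The term `{a_i, f}`, modulo an ideal containing the restrictions of all `{a_i, b_k}`. -/
lemma holCoeff_sum_pderiv_mul {P : GenIdx n → GenIdx n → MvPolynomial (GenIdx n) ℂ}
    (hw : ∀ s t, (P s t).IsWeightedHomogeneous (charge n) (charge n s + charge n t))
    (f : MvPolynomial (GenIdx n) ℂ) {I : Ideal (MvPolynomial (Fin 4) ℂ)} (i m : Fin (n + 1))
    (hI : ∀ k, restrictVars (P (Sum.inr (Sum.inl i)) (Sum.inr (Sum.inr k))) ∈ I) :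
    holCoeff m (∑ s, pderiv s f * P (Sum.inr (Sum.inl i)) s) -
      ∑ l, pderiv l (restrictVars f) * holCoeff m (P (Sum.inr (Sum.inl i)) (Sum.inl l)) ∈ I := by
  have hsum : holCoeff m (∑ s, pderiv s f * P (Sum.inr (Sum.inl i)) s) =
      ∑ s, holCoeff m (pderiv s f * P (Sum.inr (Sum.inl i)) s) := by simp [holCoeff]
  rw [hsum, Fintype.sum_sum_type, Fintype.sum_sum_type]
  have hx : ∀ l, holCoeff m (pderiv (Sum.inl l) f * P (Sum.inr (Sum.inl i)) (Sum.inl l)) =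
      pderiv l (restrictVars f) * holCoeff m (P (Sum.inr (Sum.inl i)) (Sum.inl l)) := fun l => by
    rw [holCoeff_pderiv_mul, restrictVars_pderiv,
      restrictVars_eq_zero_of_charge (hw _ _) (by simp [charge]), mul_zero, add_zero]
  have ha : ∀ l, holCoeff m (pderiv (Sum.inr (Sum.inl l)) f *
      P (Sum.inr (Sum.inl i)) (Sum.inr (Sum.inl l))) = 0 := fun l => by
    rw [holCoeff_pderiv_mul, restrictVars_eq_zero_of_charge (hw _ _) (by simp [charge]),
      holCoeff_eq_zero_of_charge m (hw _ _) (by simp [charge]), mul_zero, mul_zero, add_zero]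
  have hb : ∀ k, holCoeff m (pderiv (Sum.inr (Sum.inr k)) f *
      P (Sum.inr (Sum.inl i)) (Sum.inr (Sum.inr k))) ∈ I := fun k => by
    rw [holCoeff_pderiv_mul, holCoeff_eq_zero_of_charge m (hw _ _) (by simp [charge]),
      mul_zero, zero_add]
    exact I.mul_mem_left _ (hI k)
  simp only [hx, ha, Finset.sum_const_zero, zero_add, add_sub_cancel_left]
  exact Ideal.sum_mem _ fun k _ => hb k

/-- The term `{b_k, {a_i, a_j}}`. -/
lemma holCoeff_sum_pderiv_mul_mem {P : GenIdx n → GenIdx n → MvPolynomial (GenIdx n) ℂ}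
    (hw : ∀ s t, (P s t).IsWeightedHomogeneous (charge n) (charge n s + charge n t))
    {f : MvPolynomial (GenIdx n) ℂ} (hf : f.IsWeightedHomogeneous (charge n) 2)
    {I : Ideal (MvPolynomial (Fin 4) ℂ)} (k m : Fin (n + 1))
    (hI : ∀ i, restrictVars (P (Sum.inr (Sum.inr k)) (Sum.inr (Sum.inl i))) ∈ I) :
    holCoeff m (∑ s, pderiv s f * P (Sum.inr (Sum.inr k)) s) ∈ I := by
  have hsum : holCoeff m (∑ s, pderiv s f * P (Sum.inr (Sum.inr k)) s) =
      ∑ s, holCoeff m (pderiv s f * P (Sum.inr (Sum.inr k)) s) := by simp [holCoeff]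
  rw [hsum]
  refine Ideal.sum_mem _ fun s _ => ?_
  have hs : restrictVars (pderiv s f) = 0 :=
    restrictVars_eq_zero_of_charge (hf.pderiv (n' := 2 - charge n s) (by simp))
      (by rcases s with l | i | k <;> simp [charge])
  rw [holCoeff_pderiv_mul, hs, zero_mul, zero_add]
  refine I.mul_mem_left _ ?_
  rcases s with l | i | k'
  · rw [restrictVars_eq_zero_of_charge (hw _ _) (by simp [charge])]
    exact I.zero_mem
  · exact hI i
  · rw [restrictVars_eq_zero_of_charge (hw _ _) (by simp [charge])]
    exact I.zero_mem

/-- No charge-preserving bracket on the generators satisfies antisymmetry, the Jacobi identity and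
compatibility with the symplectic bracket up to order `2n`. -/
theorem not_exists_truncated_bracket (hn : 3 ≤ n) {K : ℕ} (hK : 2 * n ≤ K)
    (P : GenIdx n → GenIdx n → MvPolynomial (GenIdx n) ℂ)
    (hw : ∀ s t, (P s t).IsWeightedHomogeneous (charge n) (charge n s + charge n t))
    (hanti : ∀ s t, P s t + P t s ∈ idealOfVars (GenIdx n) ℂ ^ K)
    (hjac : ∀ r s t, ∑ q, pderiv q (P s t) * P r q + ∑ q, pderiv q (P t r) * P s q +
      ∑ q, pderiv q (P r s) * P t q ∈ idealOfVars (GenIdx n) ℂ ^ K)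
    (hgen : ∀ s t, aeval (gen n) (P s t) - sympBr (gen n s) (gen n t) ∈
      idealOfVars (Fin 4) ℂ ^ K) : False := by
  have hcoeff : ∀ s t d, (∀ e, totalExp n e = totalExp n d → e = d) →
      (totalExp n d).degree < K →
      coeff d (P s t) = coeff (totalExp n d) (sympBr (gen n s) (gen n t)) := fun s t d hd hdeg => by
    rw [← coeff_aeval_gen hd, ← sub_eq_zero, ← coeff_sub]
    exact (mem_pow_idealOfVars_iff' _ _).mp (hgen s t) _ hdeg
  let f (j k : Fin (n + 1)) := restrictVars (P (Sum.inr (Sum.inl j)) (Sum.inr (Sum.inr k)))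
  let f' (k j : Fin (n + 1)) := restrictVars (P (Sum.inr (Sum.inr k)) (Sum.inr (Sum.inl j)))
  have hff' : ∀ j k, f j k + f' k j ∈ idealOfVars (Fin 4) ℂ ^ K := fun j k => by
    simpa only [f, f', map_add] using restrictVars_mem_pow (hanti _ _)
  have hf0 : ∀ j k, coeff 0 (f j k) = 0 := fun j k => by
    rw [coeff_restrictVars, Finsupp.mapDomain_zero,
      hcoeff _ _ 0 (eq_zero_of_totalExp (by omega)) (by simp [totalExp]; omega)]
    simpa [totalExp] using coeff_zero_sympBr_hol_antihol hn j k
  have hρ : ∀ i m l, holCoeff m (P (Sum.inr (Sum.inl i)) (Sum.inl l)) - C (structConst n i l m) ∈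
      idealOfVars (Fin 4) ℂ := fun i m l => by
    rw [mem_idealOfVars_iff, coeff_sub, coeff_zero_C, holCoeff, coeff_restrictVars,
      Finsupp.mapDomain_zero, coeff_pderiv, zero_add,
      hcoeff _ _ _ (eq_single_of_totalExp_hol (by omega) m), totalExp_single,
      coeff_sympBr_hol_quadratic]
    · simp
    · rw [totalExp_single, genExp, Finsupp.degree_eq_sum]
      simp [Fin.sum_univ_four]
      omega
  have key : ∀ d < n, ∀ j k, f j k ∈ idealOfVars (Fin 4) ℂ ^ (d + 1) := by
    intro d
    induction d with
    | zero => exact fun _ j k => by simpa using mem_idealOfVars_iff.mpr (hf0 j k)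
    | succ d ih =>
      intro hd j k
      specialize ih (by omega)
      set I := idealOfVars (Fin 4) ℂ
      have hKd : I ^ K ≤ I ^ (d + 1) := Ideal.pow_le_pow_right (by omega)
      have hf' : ∀ k j, f' k j ∈ I ^ (d + 1) := fun k j => by
        simpa using Ideal.sub_mem _ (hKd (hff' j k)) (ih j k)
      have hdf' : ∀ i k l, pderiv l (f i k) + pderiv l (f' k i) ∈ I ^ (d + 1) := fun i k l => by
        rw [← map_add]
        exact pderiv_mem_pow_idealOfVars
          (Ideal.pow_le_pow_right (by omega : d + 1 + 1 ≤ K) (hff' i k)) l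
      have hlin : ∀ (g : MvPolynomial (Fin 4) ℂ), g ∈ I ^ (d + 1) → ∀ i m l,
          pderiv l g * holCoeff m (P (Sum.inr (Sum.inl i)) (Sum.inl l)) -
            structConst n i l m • pderiv l g ∈ I ^ (d + 1) := fun g hg i m l => by
        rw [smul_eq_C_mul, mul_comm (C _), ← mul_sub, pow_succ]
        exact Ideal.mul_mem_mul (pderiv_mem_pow_idealOfVars hg l) (hρ i m l)
      have hterm : ∀ (g : MvPolynomial (GenIdx n) ℂ), restrictVars g ∈ I ^ (d + 1) → ∀ i m,
          holCoeff m (∑ s, pderiv s g * P (Sum.inr (Sum.inl i)) s) -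
            ∑ l, structConst n i l m • pderiv l (restrictVars g) ∈ I ^ (d + 1) :=
        fun g hg i m => by
        have h := Ideal.add_mem _ (holCoeff_sum_pderiv_mul hw g i m (ih i))
          (Ideal.sum_mem _ fun l (_ : l ∈ Finset.univ) => hlin _ hg i m l)
        rwa [Finset.sum_sub_distrib, sub_add_sub_cancel] at h
      have hsymm : ∀ i j m : Fin (n + 1), ∑ l, structConst n i l m • pderiv l (f j k) -
          ∑ l, structConst n j l m • pderiv l (f i k) ∈ I ^ (d + 1) := fun i j m => by
        have h0 : holCoeff m _ ∈ I ^ (d + 1) := restrictVars_mem_pow (pderiv_mem_pow_idealOfVars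
          (Ideal.pow_le_pow_right (by omega : d + 1 + 1 ≤ K)
            (hjac (Sum.inr (Sum.inl i)) (Sum.inr (Sum.inl j)) (Sum.inr (Sum.inr k)))) _)
        have h1 := hterm _ (ih j k) i m
        have h2 := hterm _ (hf' k i) j m
        have h3 := holCoeff_sum_pderiv_mul_mem hw
          (hw (Sum.inr (Sum.inl i)) (Sum.inr (Sum.inl j))) k m (hf' k)
        have h4 := Ideal.sum_mem _ fun l (_ : l ∈ Finset.univ) =>
          Submodule.smul_of_tower_mem (I ^ (d + 1)) (structConst n j l m) (hdf' i k l)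
        simp only [smul_add, Finset.sum_add_distrib] at h4
        simp only [holCoeff, map_add] at h0 h1 h2 h3
        convert Ideal.sub_mem _ (Ideal.sub_mem _ (Ideal.sub_mem _ (Ideal.sub_mem _ h0 h1) h2) h3) h4
          using 1
        ring
      refine mem_pow_succ_idealOfVars_of_pderiv (hf0 j k) fun l => ?_
      let F (j : ℕ) (l : Fin 4) : MvPolynomial (Fin 4) ℂ ⧸ I ^ (d + 1) :=
        Ideal.Quotient.mk _ (pderiv l (f (Fin.ofNat (n + 1) j) k))
      have hF := eq_zero_of_structConst_symm hn F fun i hi j hj m hm => by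
        have h := hsymm (Fin.ofNat (n + 1) i) (Fin.ofNat (n + 1) j) (Fin.ofNat (n + 1) m)
        rw [← Ideal.Quotient.mk_eq_mk_iff_sub_mem, map_sum, map_sum] at h
        simp only [Fin.val_ofNat, Nat.mod_eq_of_lt (Nat.lt_succ_of_le hi),
          Nat.mod_eq_of_lt (Nat.lt_succ_of_le hj), Nat.mod_eq_of_lt (Nat.lt_succ_of_le hm)] at h
        exact h
      have := hF j (by omega) l
      rwa [Ideal.Quotient.eq_zero_iff_mem, Fin.ofNat_eq_cast, Fin.cast_val_eq_self] at this
  have h1 := (mem_pow_idealOfVars_iff' _ _).mp (key (n - 1) (by omega) 0 0)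
    (Finsupp.single 0 (n - 1)) (by rw [Finsupp.degree_single]; omega)
  rw [coeff_restrictVars, Finsupp.mapDomain_single,
    hcoeff _ _ _ (eq_single_of_totalExp_quadratic (by omega)),
    coeff_sympBr_hol_antihol (by omega)] at h1
  · have : n ≠ 0 := by omega
    simp [this] at h1
  · rw [Finsupp.degree_eq_sum]
    simp only [totalExp_single_quadratic]
    simp [Fin.sum_univ_four]
    omega

end Endgame

section GeneralizedEigenspaces

variable {V : Type*} [AddCommGroup V] [Module ℂ V]

/-- The vectors which are generalized eigenvectors of `D` modulo `J`. -/
def genEigenspaceMod (D : Module.End ℂ V) (J : Submodule ℂ V) (hJ : J ≤ J.comap D) (c : ℂ) :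
    Submodule ℂ V :=
  (Module.End.maxGenEigenspace (J.mapQ J D hJ) c).comap J.mkQ

variable {D : Module.End ℂ V} {J : Submodule ℂ V} {hJ : J ≤ J.comap D}

lemma le_comap_sub_smul_one (hJ : J ≤ J.comap D) (c : ℂ) : J ≤ J.comap (D - c • 1) :=
  fun _ hx => J.sub_mem (hJ hx) (J.smul_mem c hx)

lemma mem_genEigenspaceMod {c : ℂ} {x : V} :
    x ∈ genEigenspaceMod D J hJ c ↔ ∃ k : ℕ, ((D - c • 1) ^ k) x ∈ J := by
  have h : J.mapQ J D hJ - c • 1 = J.mapQ J (D - c • 1) (le_comap_sub_smul_one hJ c) := by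
    ext
    rfl
  rw [genEigenspaceMod, Submodule.mem_comap, Module.End.mem_maxGenEigenspace]
  refine exists_congr fun k => ?_
  rw [h, ← Submodule.mapQ_pow, Submodule.mkQ_apply, Submodule.mapQ_apply,
    Submodule.Quotient.mk_eq_zero]

lemma sub_smul_one_pow_apply_mem (hJ : J ≤ J.comap D) (c : ℂ) (k : ℕ) {x : V} (hx : x ∈ J) :
    ((D - c • 1) ^ k) x ∈ J :=
  Submodule.le_comap_pow_of_le_comap J (le_comap_sub_smul_one hJ c) k hx

/-- A bilinear operation for which `D` is a derivation adds generalized eigenvalues. -/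
lemma apply_mem_genEigenspaceMod (β : V →ₗ[ℂ] V →ₗ[ℂ] V)
    (hD : ∀ x y, D (β x y) = β (D x) y + β x (D y))
    (hl : ∀ x ∈ J, ∀ y, β x y ∈ J) (hr : ∀ x, ∀ y ∈ J, β x y ∈ J) {a b : ℂ} {x y : V}
    (hx : x ∈ genEigenspaceMod D J hJ a) (hy : y ∈ genEigenspaceMod D J hJ b) :
    β x y ∈ genEigenspaceMod D J hJ (a + b) := by
  rw [mem_genEigenspaceMod] at hx hy ⊢
  obtain ⟨i, hx⟩ := hx
  obtain ⟨j, hy⟩ := hy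
  refine ⟨i + j, ?_⟩
  generalize hN : i + j = N
  induction N generalizing i j x y with
  | zero =>
    obtain rfl : i = 0 := by omega
    exact hl _ hx _
  | succ N ih =>
    rcases i with _ | i
    · exact sub_smul_one_pow_apply_mem hJ _ _ (hl _ hx _)
    rcases j with _ | j
    · exact sub_smul_one_pow_apply_mem hJ _ _ (hr _ _ hy)
    have h : (D - (a + b) • 1) (β x y) = β ((D - a • 1) x) y + β x ((D - b • 1) y) := by
      simp only [LinearMap.sub_apply, LinearMap.smul_apply, Module.End.one_apply, map_sub, map_smul,
        hD]
      module
    rw [pow_succ, Module.End.mul_apply, h, map_add]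
    refine J.add_mem (ih i ?_ (j + 1) hy (by omega)) (ih (i + 1) hx j ?_ (by omega))
    · rwa [pow_succ, Module.End.mul_apply] at hx
    · rwa [pow_succ, Module.End.mul_apply] at hy

/-- An eigenvector lifts to a generalized eigenvector modulo `J`. -/
lemma exists_mem_genEigenspaceMod [FiniteDimensional ℂ (V ⧸ J)] {W : Type*} [AddCommGroup W]
    [Module ℂ W] (φ : V →ₗ[ℂ] W) {δ : Module.End ℂ W} (hφ : ∀ v, φ (D v) = δ (φ v)) {c : ℂ}
    (x : V) (hx : δ (φ x) = c • φ x) : ∃ u ∈ genEigenspaceMod D J hJ c, φ u = φ x := by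
  have hpow : ∀ k : ℕ, φ ((D ^ k) x) = c ^ k • φ x := fun k => by
    induction k with
    | zero => simp
    | succ k ih =>
      rw [pow_succ', Module.End.mul_apply, hφ, ih, map_smul, hx, smul_smul, pow_succ]
  have heval : ∀ p : Polynomial ℂ, φ (Polynomial.aeval D p x) = p.eval c • φ x := fun p => by
    induction p using Polynomial.induction_on' with
    | add p q hp hq => simp [hp, hq, add_smul]
    | monomial k r => simp [Polynomial.aeval_monomial, hpow, smul_smul]
  let D' : Module.End ℂ (V ⧸ J) := J.mapQ J D hJ
  obtain ⟨r, hr, hrc⟩ := Polynomial.exists_eq_pow_rootMultiplicity_mul_and_not_dvd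
    (minpoly ℂ D') (minpoly.ne_zero (Algebra.IsIntegral.isIntegral D')) c
  rw [Polynomial.dvd_iff_isRoot, Polynomial.IsRoot.def] at hrc
  have hmk : ∀ p : Polynomial ℂ, J.mkQ (Polynomial.aeval D p x) =
      Polynomial.aeval D' p (J.mkQ x) := fun p => by
    induction p using Polynomial.induction_on' with
    | add p q hp hq => simp only [map_add, LinearMap.add_apply, hp, hq]
    | monomial k r =>
      simp only [Polynomial.aeval_monomial, Module.End.mul_apply,
        Module.algebraMap_end_apply, map_smul]
      rw [← Submodule.mapQ_pow, Submodule.mkQ_apply, Submodule.mkQ_apply, Submodule.mapQ_apply]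
  refine ⟨(r.eval c)⁻¹ • Polynomial.aeval D r x, Submodule.smul_mem _ _ ?_, ?_⟩
  · refine mem_genEigenspaceMod.mpr ⟨Polynomial.rootMultiplicity c (minpoly ℂ D'), ?_⟩
    have h := hmk (minpoly ℂ D')
    rw [minpoly.aeval, LinearMap.zero_apply, Submodule.mkQ_apply,
      Submodule.Quotient.mk_eq_zero, hr] at h
    simpa [Algebra.algebraMap_eq_smul_one] using h
  · rw [map_smul, heval, inv_smul_smul₀ hrc]

lemma mem_of_mem_genEigenspaceMod_of_mem_iSup {c : ℂ} {x : V}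
    (hx : x ∈ genEigenspaceMod D J hJ c) (hx' : x ∈ ⨆ b ≠ c, genEigenspaceMod D J hJ b) :
    x ∈ J := by
  have h := Module.End.independent_maxGenEigenspace (J.mapQ J D hJ) c
  rw [← Submodule.Quotient.mk_eq_zero]
  refine (Submodule.disjoint_def.mp h) _ hx ?_
  have hle : (⨆ b ≠ c, genEigenspaceMod D J hJ b) ≤
      (⨆ b ≠ c, Module.End.maxGenEigenspace (J.mapQ J D hJ) b).comap J.mkQ :=
    iSup₂_le fun b hb => Submodule.comap_mono (le_iSup₂_of_le b hb le_rfl)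
  exact hle hx'

end GeneralizedEigenspaces

section Invariants

lemma gAut_monomial (ζ : ℂ) (e : Fin 4 →₀ ℕ) (r : ℂ) :
    gAut ζ (monomial e r) = monomial e (ζ ^ (e 0 + e 2) * ζ⁻¹ ^ (e 1 + e 3) * r) := by
  rw [gAut, aeval_monomial, Finsupp.prod_fintype _ _ (by simp), Fin.prod_univ_four,
    monomial_eq (s := e), Finsupp.prod_fintype _ _ (by simp), Fin.prod_univ_four]
  simp only [Matrix.cons_val, mul_pow, map_mul, map_pow, algebraMap_eq]
  ring

lemma coeff_gAut (ζ : ℂ) (e : Fin 4 →₀ ℕ) (p : MvPolynomial (Fin 4) ℂ) :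
    coeff e (gAut ζ p) = ζ ^ (e 0 + e 2) * ζ⁻¹ ^ (e 1 + e 3) * coeff e p := by
  classical
  induction p using MvPolynomial.induction_on' with
  | add p q hp hq => rw [map_add, coeff_add, coeff_add, hp, hq, mul_add]
  | monomial d r =>
    rw [gAut_monomial, coeff_monomial, coeff_monomial]
    split_ifs with h
    · rw [h]
    · rw [mul_zero]

variable {n : ℕ} {ζ : ℂ}

lemma modEq_of_gAut_eq (hn : 0 < n) (hζ : IsPrimitiveRoot ζ n) {p : MvPolynomial (Fin 4) ℂ}
    (hp : gAut ζ p = p) {e : Fin 4 →₀ ℕ} (he : coeff e p ≠ 0) :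
    e 0 + e 2 ≡ e 1 + e 3 [MOD n] := by
  have h0 : ζ ≠ 0 := hζ.ne_zero hn.ne'
  have h := coeff_gAut ζ e p
  rw [hp, eq_comm, mul_eq_right₀ he, inv_pow, mul_inv_eq_one₀ (pow_ne_zero _ h0)] at h
  rw [Nat.modEq_iff_dvd, ← hζ.zpow_eq_one_iff_dvd, zpow_sub₀ h0, zpow_natCast, zpow_natCast, h,
    div_self (pow_ne_zero _ h0)]

lemma natCast_mul_charge (n : ℕ) (s : GenIdx n) :
    (n : ℤ) * charge n s =
      genExp n s 0 + genExp n s 2 - (genExp n s 1 + genExp n s 3) := by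
  rcases s with l | i | k
  · fin_cases l <;> simp [charge, genExp]
  · have := i.isLt
    simp [charge, genExp]
    omega
  · have := k.isLt
    simp [charge, genExp]
    omega

lemma gAut_gen (hζ : IsPrimitiveRoot ζ n) (hn : 0 < n) (s : GenIdx n) :
    gAut ζ (gen n s) = gen n s := by
  have h0 : ζ ≠ 0 := hζ.ne_zero hn.ne'
  rw [gen, gAut_monomial, mul_one, inv_pow, ← zpow_natCast, ← zpow_natCast, ← zpow_neg,
    ← zpow_add₀ h0]
  congr
  push_cast
  rw [← sub_eq_add_neg, ← natCast_mul_charge, zpow_mul, zpow_natCast, hζ.pow_eq_one, one_zpow]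

lemma eq_zero_or_eq_zero_of_add_eq_genExp (hn : 2 ≤ n) {d e : Fin 4 →₀ ℕ} {s : GenIdx n}
    (h : d + e = genExp n s) (hd : d 0 + d 2 ≡ d 1 + d 3 [MOD n])
    (he : e 0 + e 2 ≡ e 1 + e 3 [MOD n]) : d = 0 ∨ e = 0 := by
  suffices (d 0 + d 2 = 0 ∧ d 1 + d 3 = 0) ∨ (e 0 + e 2 = 0 ∧ e 1 + e 3 = 0) by
    refine this.imp (fun h => ?_) fun h => ?_ <;>
    · ext c
      fin_cases c <;> simp <;> omega
  have h0 := DFunLike.congr_fun h 0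
  have h1 := DFunLike.congr_fun h 1
  have h2 := DFunLike.congr_fun h 2
  have h3 := DFunLike.congr_fun h 3
  rcases s with l | i | k
  · have hd' := fun h1 h2 => Nat.ModEq.eq_of_lt_of_lt hd h1 h2
    have he' := fun h1 h2 => Nat.ModEq.eq_of_lt_of_lt he h1 h2
    fin_cases l <;> simp [genExp] at h0 h1 h2 h3 <;> omega
  · simp [genExp] at h0 h1 h2 h3
    rw [h1.1, h3.1, Nat.modEq_zero_iff_dvd] at hd
    rcases Nat.eq_zero_or_pos (d 0 + d 2) with h | h
    · omega
    · have := Nat.le_of_dvd h hd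
      omega
  · simp [genExp] at h0 h1 h2 h3
    rw [h0.1, h2.1, Nat.ModEq.comm, Nat.modEq_zero_iff_dvd] at hd
    rcases Nat.eq_zero_or_pos (d 1 + d 3) with h | h
    · omega
    · have := Nat.le_of_dvd h hd
      omega

lemma genExp_injective (hn : 3 ≤ n) : Function.Injective (genExp n) := by
  intro s t h
  simp only [Finsupp.ext_iff, Fin.forall_fin_succ] at h
  rcases s with l | i | k <;> rcases t with l' | i' | k'
  · fin_cases l <;> fin_cases l' <;> simp [genExp] at h ⊢
  · fin_cases l <;> simp [genExp] at h
  · fin_cases l <;> simp [genExp] at h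
  · fin_cases l' <;> simp [genExp] at h
  · simp [genExp] at h
    rw [Fin.ext h.2]
  · simp [genExp] at h
    omega
  · fin_cases l' <;> simp [genExp] at h
  · simp [genExp] at h
    omega
  · simp [genExp] at h
    rw [Fin.ext h.2]

lemma sympBr_gen_quadratic (s : GenIdx n) :
    sympBr (gen n s) (gen n (Sum.inl 0) + gen n (Sum.inl 3)) =
      ((n : ℂ) * charge n s) • gen n s := by
  have h : ((n : ℂ) * charge n s) =
      genExp n s 0 + genExp n s 2 - (genExp n s 1 + genExp n s 3) := by
    exact_mod_cast natCast_mul_charge n s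
  have h0 : gen n (Sum.inl 0) = X 0 * X 1 := by
    rw [gen, X, X, monomial_mul, mul_one]
    congr
    ext c
    fin_cases c <;> simp [genExp]
  have h3 : gen n (Sum.inl 3) = X 2 * X 3 := by
    rw [gen, X, X, monomial_mul, mul_one]
    congr
    ext c
    fin_cases c <;> simp [genExp]
  have hX : ∀ i, pderiv i (gen n s) * X i = (genExp n s i : ℂ) • gen n s := fun i => by
    rw [mul_comm, gen, X_mul_pderiv_monomial, Nat.cast_smul_eq_nsmul]
  calc _ = pderiv 0 (gen n s) * X 0 - pderiv 1 (gen n s) * X 1 +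
        pderiv 2 (gen n s) * X 2 - pderiv 3 (gen n s) * X 3 := by
        rw [sympBr, h0, h3]
        simp [pderiv_X]
    _ = _ := by
        rw [hX, hX, hX, hX, h]
        module

end Invariants

section Substitution

variable {σ : Type*}

lemma mem_sq_idealOfVars {p : MvPolynomial σ ℂ} (h0 : p ∈ idealOfVars σ ℂ)
    (h1 : ∀ s, coeff (Finsupp.single s 1) p = 0) : p ∈ idealOfVars σ ℂ ^ 2 := by
  refine mem_pow_succ_idealOfVars_of_pderiv (mem_idealOfVars_iff.mp h0) fun s => ?_
  rw [pow_one, mem_idealOfVars_iff, coeff_pderiv, zero_add, h1, zero_mul]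

lemma coeff_zero_map {τ : Type*} (ψ : MvPolynomial σ ℂ →ₐ[ℂ] MvPolynomial τ ℂ)
    (hψ : ∀ s, ψ (X s) ∈ idealOfVars τ ℂ) (p : MvPolynomial σ ℂ) :
    coeff 0 (ψ p) = coeff 0 p := by
  have h : p - C (coeff 0 p) ∈ idealOfVars σ ℂ ^ 1 := by
    rw [pow_one, mem_idealOfVars_iff, coeff_sub, coeff_zero_C, sub_self]
  have h' := map_mem_pow_idealOfVars ψ hψ h
  rwa [pow_one, mem_idealOfVars_iff, map_sub, algHom_C, algebraMap_eq, coeff_sub, coeff_zero_C,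
    sub_eq_zero] at h'

lemma derivation_mem_pow {A : Type*} [CommRing A] [Algebra ℂ A] (d : Derivation ℂ A A)
    {I : Ideal A} (hd : ∀ a ∈ I, d a ∈ I) (k : ℕ) : ∀ a ∈ I ^ k, d a ∈ I ^ k := by
  induction k with
  | zero => simp
  | succ k ih =>
    intro a ha
    rw [pow_succ] at ha ⊢
    induction ha using Submodule.mul_induction_on' with
    | mem_mul_mem f hf g hg =>
      rw [d.leibniz, smul_eq_mul, smul_eq_mul, mul_comm g]
      exact Ideal.add_mem _ (Ideal.mul_mem_mul hf (hd g hg)) (Ideal.mul_mem_mul (ih f hf) hg)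
    | add f _ g _ hf hg =>
      rw [map_add]
      exact Ideal.add_mem _ hf hg

lemma derivation_aeval [Fintype σ] {A : Type*} [CommRing A] [Algebra ℂ A]
    (d : Derivation ℂ A A) (u : σ → A) (p : MvPolynomial σ ℂ) :
    d (aeval u p) = ∑ s, aeval u (pderiv s p) * d (u s) := by
  classical
  induction p using MvPolynomial.induction_on with
  | C r => simp
  | add p q hp hq => simp only [map_add, hp, hq, add_mul, Finset.sum_add_distrib]
  | mul_X p s hp =>
    simp only [map_mul, aeval_X, Derivation.leibniz, hp, smul_eq_mul, pderiv_X, map_add, add_mul,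
      Finset.sum_add_distrib, Finset.mul_sum, Pi.single_apply]
    congr 1
    · simp [ite_mul, apply_ite]
    · exact Finset.sum_congr rfl fun t _ => by ring

instance finiteDimensional_quotient_pow_idealOfVars [Finite σ] (k : ℕ) :
    FiniteDimensional ℂ
      (MvPolynomial σ ℂ ⧸ (idealOfVars σ ℂ ^ k).restrictScalars ℂ) := by
  have := (Finsupp.finite_of_degree_lt (σ := σ) k).to_subtype
  let T : MvPolynomial σ ℂ →ₗ[ℂ] ({d : σ →₀ ℕ | d.degree < k} → ℂ) :=
    LinearMap.pi fun d => lcoeff ℂ d.1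
  have hT : (idealOfVars σ ℂ ^ k).restrictScalars ℂ = T.ker := by
    ext p
    simp [T, mem_pow_idealOfVars_iff', funext_iff, lcoeff]
  rw [hT]
  exact Module.Finite.equiv T.quotKerEquivRange.symm

lemma aeval_mem_pow_idealOfVars {u : σ → MvPolynomial σ ℂ} (hu : ∀ s, u s ∈ idealOfVars σ ℂ)
    {p : MvPolynomial σ ℂ} {k : ℕ} (hp : p ∈ idealOfVars σ ℂ ^ k) :
    aeval u p ∈ idealOfVars σ ℂ ^ k :=
  map_mem_pow_idealOfVars _ (fun s => by rw [aeval_X]; exact hu s) hp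

lemma exists_sub_aeval_mem_pow_succ {u : σ → MvPolynomial σ ℂ}
    (hu : ∀ s, u s ∈ idealOfVars σ ℂ)
    (hlin : ∀ g ∈ idealOfVars σ ℂ, ∃ q ∈ idealOfVars σ ℂ, g - aeval u q ∈ idealOfVars σ ℂ ^ 2)
    (k : ℕ) :
    ∀ p ∈ idealOfVars σ ℂ ^ k,
    ∃ q ∈ idealOfVars σ ℂ ^ k, p - aeval u q ∈ idealOfVars σ ℂ ^ (k + 1) := by
  induction k with
  | zero =>
    intro p _
    refine ⟨C (coeff 0 p), by simp, ?_⟩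
    rw [zero_add, pow_one, mem_idealOfVars_iff, algHom_C, algebraMap_eq, coeff_sub, coeff_zero_C,
      sub_self]
  | succ k ih =>
    intro p hp
    rw [pow_succ] at hp
    induction hp using Submodule.mul_induction_on' with
    | mem_mul_mem f hf g hg =>
      obtain ⟨q₁, hq₁, h₁⟩ := ih f hf
      obtain ⟨q₂, hq₂, h₂⟩ := hlin g hg
      refine ⟨q₁ * q₂, by rw [pow_succ]; exact Ideal.mul_mem_mul hq₁ hq₂, ?_⟩
      have h : f * g - aeval u (q₁ * q₂) =
          (f - aeval u q₁) * g + aeval u q₁ * (g - aeval u q₂) := by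
        rw [map_mul]
        ring
      rw [h]
      refine Ideal.add_mem _ ?_ ?_
      · rw [pow_succ]
        exact Ideal.mul_mem_mul h₁ hg
      · rw [add_assoc, pow_add]
        exact Ideal.mul_mem_mul (aeval_mem_pow_idealOfVars hu hq₁) h₂
    | add f _ g _ hf hg =>
      obtain ⟨q₁, hq₁, h₁⟩ := hf
      obtain ⟨q₂, hq₂, h₂⟩ := hg
      refine ⟨q₁ + q₂, Ideal.add_mem _ hq₁ hq₂, ?_⟩
      rw [map_add, add_sub_add_comm]
      exact Ideal.add_mem _ h₁ h₂

lemma exists_sub_aeval_mem_pow {u : σ → MvPolynomial σ ℂ}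
    (hu : ∀ s, u s ∈ idealOfVars σ ℂ)
    (hlin : ∀ g ∈ idealOfVars σ ℂ, ∃ q ∈ idealOfVars σ ℂ, g - aeval u q ∈ idealOfVars σ ℂ ^ 2)
    (k : ℕ) (p : MvPolynomial σ ℂ) :
    ∃ q : MvPolynomial σ ℂ, p - aeval u q ∈ idealOfVars σ ℂ ^ k := by
  induction k with
  | zero => exact ⟨0, by simp⟩
  | succ k ih =>
    obtain ⟨q, hq⟩ := ih
    obtain ⟨q', -, hq'⟩ := exists_sub_aeval_mem_pow_succ hu hlin k _ hq
    exact ⟨q + q', by rwa [map_add, ← sub_sub]⟩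

lemma mem_pow_of_aeval_mem_pow [Finite σ] {u : σ → MvPolynomial σ ℂ}
    (hu : ∀ s, u s ∈ idealOfVars σ ℂ)
    (hlin : ∀ g ∈ idealOfVars σ ℂ, ∃ q ∈ idealOfVars σ ℂ, g - aeval u q ∈ idealOfVars σ ℂ ^ 2)
    {k : ℕ} {q : MvPolynomial σ ℂ}
    (hq : aeval u q ∈ idealOfVars σ ℂ ^ k) : q ∈ idealOfVars σ ℂ ^ k := by
  let J := (idealOfVars σ ℂ ^ k).restrictScalars ℂ
  let T : MvPolynomial σ ℂ ⧸ J →ₗ[ℂ] MvPolynomial σ ℂ ⧸ J :=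
    J.mapQ J (aeval u).toLinearMap fun p hp => aeval_mem_pow_idealOfVars hu hp
  have hsurj : Function.Surjective T := fun x => by
    obtain ⟨p, rfl⟩ := J.mkQ_surjective x
    obtain ⟨q, hq⟩ := exists_sub_aeval_mem_pow hu hlin k p
    exact ⟨J.mkQ q, ((Submodule.Quotient.eq J).mpr hq).symm⟩
  have hzero : T (J.mkQ q) = T 0 := by
    rw [map_zero]
    exact (Submodule.Quotient.mk_eq_zero J).mpr hq
  exact (Submodule.Quotient.mk_eq_zero J).mp (LinearMap.injective_iff_surjective.mpr hsurj hzero)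

end Substitution

section Lifting

variable {n : ℕ} {ζ : ℂ} {φ : MvPolynomial (GenIdx n) ℂ →ₐ[ℂ] MvPolynomial (Fin 4) ℂ}

lemma coeff_zero_sympBr (hn : 2 ≤ n) (hζ : IsPrimitiveRoot ζ n) {p q : MvPolynomial (Fin 4) ℂ}
    (hp : gAut ζ p = p) : coeff 0 (sympBr p q) = 0 := by
  have h : ∀ i, constantCoeff (pderiv i p) = 0 := fun i => by
    rw [constantCoeff_eq, coeff_pderiv, zero_add]
    refine mul_eq_zero_of_left ?_ _
    by_contra h
    have := (modEq_of_gAut_eq (by omega) hζ hp h)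
    fin_cases i <;> simp [Nat.ModEq, Nat.mod_eq_of_lt hn] at this
  rw [← constantCoeff_eq, sympBr]
  simp [h]

lemma coeff_genExp_map (hn : 2 ≤ n) (hζ : IsPrimitiveRoot ζ n) (hinv : ∀ p, gAut ζ (φ p) = φ p)
    (h0 : ∀ s, φ (X s) ∈ idealOfVars (Fin 4) ℂ) {p : MvPolynomial (GenIdx n) ℂ}
    (hp : p ∈ idealOfVars (GenIdx n) ℂ ^ 2) (s : GenIdx n) : coeff (genExp n s) (φ p) = 0 := by
  classical
  rw [pow_two] at hp
  induction hp using Submodule.mul_induction_on' with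
  | mem_mul_mem f hf g hg =>
    rw [map_mul, coeff_mul]
    refine Finset.sum_eq_zero fun ⟨d, e⟩ hde => ?_
    rw [Finset.HasAntidiagonal.mem_antidiagonal] at hde
    by_contra h
    rw [mul_eq_zero, not_or] at h
    rw [mem_idealOfVars_iff, ← coeff_zero_map φ h0] at hf hg
    rcases eq_zero_or_eq_zero_of_add_eq_genExp hn hde
      (modEq_of_gAut_eq (by omega) hζ (hinv f) h.1)
      (modEq_of_gAut_eq (by omega) hζ (hinv g) h.2) with rfl | rfl
    exacts [h.1 hf, h.2 hg]
  | add f _ g _ hf hg => rw [map_add, coeff_add, hf, hg, add_zero]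

lemma lift_mem_idealOfVars (hn : 3 ≤ n) (h0 : ∀ s, φ (X s) ∈ idealOfVars (Fin 4) ℂ)
    {u : GenIdx n → MvPolynomial (GenIdx n) ℂ} (hu : ∀ s, φ (u s) = gen n s) (s : GenIdx n) :
    u s ∈ idealOfVars (GenIdx n) ℂ := by
  classical
  rw [mem_idealOfVars_iff, ← coeff_zero_map φ h0, hu, gen, coeff_monomial, if_neg]
  rw [← totalExp_single]
  intro h
  have := eq_zero_of_totalExp (by omega) _ (h.trans (by simp [totalExp]))
  simp at this

lemma exists_sub_aeval_lift_mem_sq (hn : 3 ≤ n) (hζ : IsPrimitiveRoot ζ n)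
    (hinv : ∀ p, gAut ζ (φ p) = φ p) (h0 : ∀ s, φ (X s) ∈ idealOfVars (Fin 4) ℂ)
    {u : GenIdx n → MvPolynomial (GenIdx n) ℂ} (hu : ∀ s, φ (u s) = gen n s)
    (g : MvPolynomial (GenIdx n) ℂ) (hg : g ∈ idealOfVars (GenIdx n) ℂ) :
    ∃ q ∈ idealOfVars (GenIdx n) ℂ, g - aeval u q ∈ idealOfVars (GenIdx n) ℂ ^ 2 := by
  classical
  have hum := lift_mem_idealOfVars hn h0 hu
  have hcomb : ∀ c : GenIdx n → ℂ, ∑ s, c s • u s ∈ idealOfVars (GenIdx n) ℂ := fun c =>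
    Ideal.sum_mem _ fun s _ => Submodule.smul_of_tower_mem _ _ (hum s)
  let L : (GenIdx n → ℂ) →ₗ[ℂ] (GenIdx n → ℂ) :=
    LinearMap.pi fun t => lcoeff ℂ (Finsupp.single t 1) ∘ₗ Fintype.linearCombination ℂ u
  have hL : ∀ c t, L c t = coeff (Finsupp.single t 1) (∑ s, c s • u s) := fun c t => rfl
  have hinj : Function.Injective L := by
    rw [injective_iff_map_eq_zero]
    intro c hc
    have h := mem_sq_idealOfVars (hcomb c) fun t => by rw [← hL, hc, Pi.zero_apply]
    ext s
    have h' := coeff_genExp_map (by omega) hζ hinv h0 h s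
    simpa [hu, gen, coeff_sum, coeff_monomial, (genExp_injective hn).eq_iff,
      -Fintype.sum_sum_type] using h'
  obtain ⟨c, hc⟩ := LinearMap.injective_iff_surjective.mp hinj
    fun t => coeff (Finsupp.single t 1) g
  refine ⟨∑ s, c s • X s, Ideal.sum_mem _ fun s _ => Submodule.smul_of_tower_mem _ _
    (Ideal.subset_span (Set.mem_range_self s)), ?_⟩
  simp only [map_sum, map_smul, aeval_X]
  refine mem_sq_idealOfVars (Ideal.sub_mem _ hg (hcomb c)) fun t => ?_
  rw [coeff_sub, ← hL, hc, sub_self]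

end Lifting

section Poisson

variable {A : Type*} [CommRing A] [Algebra ℂ A] {B : A → A → A}

/-- A Poisson bracket as a bilinear map. -/
def bracketBilin (hB : IsPoissonBracketC B) : A →ₗ[ℂ] A →ₗ[ℂ] A :=
  LinearMap.mk₂ ℂ B hB.1 hB.2.2.1 hB.2.1 hB.2.2.2.1

/-- The Hamiltonian derivation `f ↦ B f h`. -/
def hamiltonian (hB : IsPoissonBracketC B) (h : A) : Derivation ℂ A A :=
  Derivation.mk' ((bracketBilin hB).flip h) fun f g => hB.2.2.2.2.2.2 f g h

lemma hamiltonian_apply (hB : IsPoissonBracketC B) (h f : A) : hamiltonian hB h f = B f h := rfl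

lemma hamiltonian_bracket (hB : IsPoissonBracketC B) (h f g : A) :
    hamiltonian hB h (B f g) = B (hamiltonian hB h f) g + B f (hamiltonian hB h g) := by
  have hanti := hB.2.2.2.2.1
  have hneg : ∀ f g, B f (-g) = - B f g := fun f g => map_neg (bracketBilin hB f) g
  simp only [hamiltonian_apply]
  rw [hanti (B f g), hanti (B f h), hanti f h, hneg, ← sub_eq_zero,
    ← neg_eq_zero.mpr (hB.2.2.2.2.2.1 f g h)]
  ring

lemma bracket_aeval {σ : Type*} [Fintype σ] (hB : IsPoissonBracketC B) (u : σ → A) (f : A)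
    (p : MvPolynomial σ ℂ) : B f (aeval u p) = ∑ s, aeval u (pderiv s p) * B f (u s) := by
  rw [hB.2.2.2.2.1, ← hamiltonian_apply hB, derivation_aeval, ← Finset.sum_neg_distrib]
  refine Finset.sum_congr rfl fun s _ => ?_
  rw [hamiltonian_apply, hB.2.2.2.2.1 f, mul_neg]

end Poisson

section Weights

variable {A : Type*} [CommRing A] [Algebra ℂ A] {d : Derivation ℂ A A} {I : Ideal A}
  {hI : I.restrictScalars ℂ ≤ (I.restrictScalars ℂ).comap (d : Module.End ℂ A)}

lemma mul_mem_genEigenspaceMod {a b : ℂ} {x y : A}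
    (hx : x ∈ genEigenspaceMod d (I.restrictScalars ℂ) hI a)
    (hy : y ∈ genEigenspaceMod d (I.restrictScalars ℂ) hI b) :
    x * y ∈ genEigenspaceMod d (I.restrictScalars ℂ) hI (a + b) := by
  refine apply_mem_genEigenspaceMod (LinearMap.mul ℂ A) (fun x y => ?_)
    (fun x hx y => I.mul_mem_right y hx) (fun x y hy => I.mul_mem_left x hy) hx hy
  simp [mul_comm, add_comm]

variable {σ : Type*} {u : σ → A} {w : σ → ℤ} {N : ℂ}

lemma aeval_monomial_mem_genEigenspaceMod
    (hu : ∀ s, u s ∈ genEigenspaceMod d (I.restrictScalars ℂ) hI (N * w s)) (e : σ →₀ ℕ) (r : ℂ) :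
    aeval u (monomial e r) ∈
      genEigenspaceMod d (I.restrictScalars ℂ) hI (N * (Finsupp.weight w e : ℤ)) := by
  induction e using Finsupp.induction_linear generalizing r with
  | zero =>
    refine mem_genEigenspaceMod.mpr ⟨1, ?_⟩
    simp
  | add e₁ e₂ h₁ h₂ =>
    rw [← mul_one r, ← monomial_mul, map_mul, map_add, Int.cast_add, mul_add]
    exact mul_mem_genEigenspaceMod (h₁ r) (h₂ 1)
  | single s k =>
    induction k with
    | zero =>
      refine mem_genEigenspaceMod.mpr ⟨1, ?_⟩
      simp
    | succ k ih =>
      rw [Finsupp.single_add, monomial_add_single, pow_one, map_mul, aeval_X, map_add, Int.cast_add,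
        mul_add]
      refine mul_mem_genEigenspaceMod ih ?_
      simpa [Finsupp.weight_single] using hu s

lemma aeval_sub_weightedHomogeneousComponent_mem (hN : N ≠ 0)
    (hu : ∀ s, u s ∈ genEigenspaceMod d (I.restrictScalars ℂ) hI (N * w s)) (c : ℤ)
    (p : MvPolynomial σ ℂ) :
    aeval u (p - weightedHomogeneousComponent w c p) ∈
      ⨆ b ≠ N * c, genEigenspaceMod d (I.restrictScalars ℂ) hI b := by
  induction p using MvPolynomial.induction_on' with
  | add p q hp hq =>
    rw [map_add, add_sub_add_comm, map_add]
    exact Submodule.add_mem _ hp hq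
  | monomial e r =>
    rw [weightedHomogeneousComponent_of_mem (isWeightedHomogeneous_monomial w e r rfl)]
    split_ifs with h
    · rw [sub_self, map_zero]
      exact Submodule.zero_mem _
    · rw [sub_zero]
      refine (le_iSup₂_of_le (N * (Finsupp.weight w e : ℤ)) ?_ le_rfl :
        _ ≤ ⨆ b ≠ N * c, genEigenspaceMod d (I.restrictScalars ℂ) hI b)
        (aeval_monomial_mem_genEigenspaceMod hu e r)
      simpa [hN] using Ne.symm h

lemma aeval_mem_genEigenspaceMod
    (hu : ∀ s, u s ∈ genEigenspaceMod d (I.restrictScalars ℂ) hI (N * w s)) {c : ℤ}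
    {p : MvPolynomial σ ℂ} (hp : p.IsWeightedHomogeneous w c) :
    aeval u p ∈ genEigenspaceMod d (I.restrictScalars ℂ) hI (N * c) := by
  induction hp using IsWeightedHomogeneous.induction_on with
  | zero => rw [map_zero]; exact Submodule.zero_mem _
  | add p q _ _ hp hq => rw [map_add]; exact Submodule.add_mem _ hp hq
  | monomial e r he => rw [← he]; exact aeval_monomial_mem_genEigenspaceMod hu e r

lemma sub_aeval_weightedHomogeneousComponent_mem (hN : N ≠ 0)
    (hu : ∀ s, u s ∈ genEigenspaceMod d (I.restrictScalars ℂ) hI (N * w s)) {c : ℤ} {x : A}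
    (hx : x ∈ genEigenspaceMod d (I.restrictScalars ℂ) hI (N * c)) {p : MvPolynomial σ ℂ}
    (hp : x - aeval u p ∈ I) : x - aeval u (weightedHomogeneousComponent w c p) ∈ I := by
  have h₁ := aeval_sub_weightedHomogeneousComponent_mem hN hu c p
  have h₂ := Submodule.sub_mem _ hx (aeval_mem_genEigenspaceMod hu
    (weightedHomogeneousComponent_isWeightedHomogeneous c p))
  have h₃ : aeval u (p - weightedHomogeneousComponent w c p) ∈ I.restrictScalars ℂ := by
    refine mem_of_mem_genEigenspaceMod_of_mem_iSup ?_ h₁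
    have h₄ : x - aeval u p ∈ genEigenspaceMod d (I.restrictScalars ℂ) hI (N * c) :=
      mem_genEigenspaceMod.mpr ⟨0, hp⟩
    rw [map_sub]
    simpa using Submodule.sub_mem _ h₂ h₄
  rw [map_sub] at h₃
  simpa using I.add_mem hp h₃

end Weights

section Truncation

variable {n : ℕ} {ζ : ℂ} {φ : MvPolynomial (GenIdx n) ℂ →ₐ[ℂ] MvPolynomial (Fin 4) ℂ}
  {B : MvPolynomial (GenIdx n) ℂ → MvPolynomial (GenIdx n) ℂ → MvPolynomial (GenIdx n) ℂ}

/-- The symplectic bracket with a fixed second argument. -/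
noncomputable def sympBrRight (q : MvPolynomial (Fin 4) ℂ) :
    Module.End ℂ (MvPolynomial (Fin 4) ℂ) where
  toFun p := sympBr p q
  map_add' p p' := by simp only [sympBr, map_add]; ring
  map_smul' c p := by
    simp only [sympBr, Derivation.map_smul, smul_mul_assoc, smul_sub, smul_add, RingHom.id_apply]

/-- There is no Poisson bracket on a centered presentation of `R_n` in `2n + 6` variables. -/
theorem not_poisson_of_centered (hn : 3 ≤ n) (hζ : IsPrimitiveRoot ζ n)
    (hB : IsPoissonBracketC B) (hinv : ∀ p, gAut ζ (φ p) = φ p)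
    (hsurj : ∀ p, gAut ζ p = p → ∃ q, φ q = p)
    (hbr : ∀ f g, φ (B f g) = sympBr (φ f) (φ g))
    (h0 : ∀ s, φ (X s) ∈ idealOfVars (Fin 4) ℂ) : False := by
  set m := idealOfVars (GenIdx n) ℂ with hm
  set K := 2 * n with hK
  have hanti := hB.2.2.2.2.1
  have hneg : ∀ {I : Ideal (MvPolynomial (GenIdx n) ℂ)} {f g}, B g f ∈ I → B f g ∈ I :=
    fun {I f g} h => by rw [hanti]; exact I.neg_mem h
  have hBm : ∀ f g, B f g ∈ m := fun f g => by
    rw [hm, mem_idealOfVars_iff, ← coeff_zero_map φ h0, hbr]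
    exact coeff_zero_sympBr (by omega) hζ (hinv f)
  have hl : ∀ f ∈ m ^ K, ∀ g, B f g ∈ m ^ K := fun f hf g =>
    derivation_mem_pow (hamiltonian hB g) (fun a _ => hBm a g) K f hf
  have hr : ∀ f, ∀ g ∈ m ^ K, B f g ∈ m ^ K := fun f g hg => hneg (hl g hg f)
  choose v hv using fun s => hsurj (gen n s) (gAut_gen hζ (by omega) s)
  set E := v (Sum.inl 0) + v (Sum.inl 3) with hE
  let d := hamiltonian hB E
  have hJ : (m ^ K).restrictScalars ℂ ≤ ((m ^ K).restrictScalars ℂ).comap (d : Module.End ℂ _) :=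
    fun f hf => hl f hf E
  have hφE : φ E = gen n (Sum.inl 0) + gen n (Sum.inl 3) := by rw [hE, map_add, hv, hv]
  choose u hu hφu using fun s => exists_mem_genEigenspaceMod (hJ := hJ) φ.toLinearMap
    (δ := sympBrRight (φ E)) (fun f => hbr f E) (c := (n : ℂ) * charge n s) (v s) (by
      change sympBr (φ (v s)) (φ E) = _ • φ (v s)
      rw [hφE, hv, sympBr_gen_quadratic])
  replace hφu : ∀ s, φ (u s) = gen n s := fun s => (hφu s).trans (hv s)
  have hum := lift_mem_idealOfVars hn h0 hφu
  have hlin := exists_sub_aeval_lift_mem_sq hn hζ hinv h0 hφu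
  choose q hq using fun s t => exists_sub_aeval_mem_pow hum hlin K (B (u s) (u t))
  let P (s t : GenIdx n) :=
    weightedHomogeneousComponent (charge n) (charge n s + charge n t) (q s t)
  have hP : ∀ s t, B (u s) (u t) - aeval u (P s t) ∈ m ^ K := fun s t => by
    refine sub_aeval_weightedHomogeneousComponent_mem (N := n) (by norm_cast; omega) hu ?_ (hq s t)
    have := apply_mem_genEigenspaceMod (bracketBilin hB) (hamiltonian_bracket hB E) hl hr
      (hu s) (hu t)
    rwa [← mul_add, ← Int.cast_add] at this
  refine not_exists_truncated_bracket hn hK.ge P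
    (fun s t => weightedHomogeneousComponent_isWeightedHomogeneous _ _) (fun s t => ?_)
    (fun r s t => ?_) fun s t => ?_
  · refine mem_pow_of_aeval_mem_pow hum hlin ?_
    have h := Ideal.add_mem _ (hP s t) (hP t s)
    rw [hanti (u t), sub_add_sub_comm, add_neg_cancel, zero_sub, ← map_add] at h
    exact neg_mem_iff.mp h
  · refine mem_pow_of_aeval_mem_pow hum hlin ?_
    have hterm : ∀ r s t, B (u r) (B (u s) (u t)) -
        aeval u (∑ q, pderiv q (P s t) * P r q) ∈ m ^ K := fun r s t => by
      have h₁ : B (u r) (B (u s) (u t)) - B (u r) (aeval u (P s t)) ∈ m ^ K := by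
        have h := map_sub (bracketBilin hB (u r)) (B (u s) (u t)) (aeval u (P s t))
        exact h ▸ hr (u r) _ (hP s t)
      have h₂ : B (u r) (aeval u (P s t)) - aeval u (∑ q, pderiv q (P s t) * P r q) ∈ m ^ K := by
        rw [bracket_aeval hB, map_sum, ← Finset.sum_sub_distrib]
        refine Ideal.sum_mem _ fun q _ => ?_
        rw [map_mul, ← mul_sub]
        exact Ideal.mul_mem_left _ _ (hP r q)
      simpa using Ideal.add_mem _ h₁ h₂
    have h := Ideal.add_mem _ (Ideal.add_mem _ (hterm r s t) (hterm s t r)) (hterm t r s)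
    rw [sub_add_sub_comm, sub_add_sub_comm, hB.2.2.2.2.2.1, zero_sub, ← map_add, ← map_add] at h
    exact neg_mem_iff.mp h
  · have h := map_mem_pow_idealOfVars φ h0 (hP s t)
    have hcomp : φ (aeval u (P s t)) = aeval (gen n) (P s t) := by
      rw [← AlgHom.comp_apply, comp_aeval]
      simp only [hφu]
    rw [map_sub, hbr, hφu, hφu, hcomp, ← neg_mem_iff, neg_sub] at h
    exact h

end Truncation

section Transport

lemma isPoissonBracketC_transport {A A' : Type*} [CommRing A] [Algebra ℂ A] [CommRing A']
    [Algebra ℂ A'] {B : A → A → A} (hB : IsPoissonBracketC B) (e : A ≃ₐ[ℂ] A') :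
    IsPoissonBracketC fun f g => e (B (e.symm f) (e.symm g)) := by
  obtain ⟨h₁, h₂, h₃, h₄, h₅, h₆, h₇⟩ := hB
  refine ⟨fun f g h => ?_, fun f g h => ?_, fun c f g => ?_, fun c f g => ?_, fun f g => ?_,
    fun f g h => ?_, fun f g h => ?_⟩
  · simp only [map_add, h₁]
  · simp only [map_add, h₂]
  · simp only [map_smul, h₃]
  · simp only [map_smul, h₄]
  · exact (congrArg e (h₅ _ _)).trans (map_neg e _)
  · simp only [AlgEquiv.symm_apply_apply, ← map_add, h₆, map_zero]
  · simp only [map_mul, h₇, map_add, AlgEquiv.apply_symm_apply]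

/-- Reindexing the variables by `e` and translating them by `c`. -/
noncomputable def translateEquiv {σ τ : Type*} (e : σ ≃ τ) (c : σ → ℂ) :
    MvPolynomial σ ℂ ≃ₐ[ℂ] MvPolynomial τ ℂ :=
  AlgEquiv.ofAlgHom (aeval fun i => X (e i) + C (c i))
    (aeval fun s => X (e.symm s) - C (c (e.symm s)))
    (by ext s : 1; simp) (by ext i : 1; simp)

lemma translateEquiv_symm_X {σ τ : Type*} (e : σ ≃ τ) (c : σ → ℂ) (s : τ) :
    (translateEquiv e c).symm (X s) = X (e.symm s) - C (c (e.symm s)) :=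
  aeval_X _ s

end Transport

end Nonembedding

/-- Nonembedding theorem: for odd `n ≥ 3`, the Poisson algebra of ℤ/n-invariants
`R_n ⊆ ℂ[z, z̄, w, w̄]` is not realizable as a Poisson quotient of any Poisson structure on
the polynomial ring in `2n + 6` variables: there exist no ℂ-bilinear Poisson bracket `B` on
`ℂ[u₁, …, u_{2n+6}]` and surjection `φ` onto `R_n` intertwining `B` with the symplectic
bracket. -/
theorem nonembedding_V_Zn (n : ℕ) (hn : 3 ≤ n) (hodd : Odd n) (ζ : ℂ)
    (hζ : IsPrimitiveRoot ζ n) :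
    ¬ ∃ (B : MvPolynomial (Fin (2 * n + 6)) ℂ → MvPolynomial (Fin (2 * n + 6)) ℂ →
          MvPolynomial (Fin (2 * n + 6)) ℂ)
        (φ : MvPolynomial (Fin (2 * n + 6)) ℂ →ₐ[ℂ] MvPolynomial (Fin 4) ℂ),
        IsPoissonBracketC B ∧
        Set.range φ = {p : MvPolynomial (Fin 4) ℂ | gAut ζ p = p} ∧
        (∀ f g : MvPolynomial (Fin (2 * n + 6)) ℂ, φ (B f g) = sympBr (φ f) (φ g)) := by
  rintro ⟨B, φ, hB, hφ, hbr⟩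
  have hcard : Fintype.card (Fin (2 * n + 6)) = Fintype.card (Nonembedding.GenIdx n) := by
    simp only [Nonembedding.GenIdx, Fintype.card_sum, Fintype.card_fin]
    ring
  let e := Nonembedding.translateEquiv (Fintype.equivOfCardEq hcard) fun i => coeff 0 (φ (X i))
  refine Nonembedding.not_poisson_of_centered (φ := φ.comp e.symm.toAlgHom) hn hζ
    (Nonembedding.isPoissonBracketC_transport hB e) (fun p => ?_) (fun p hp => ?_)
    (fun f g => ?_) fun s => ?_
  · exact hφ.le (Set.mem_range_self (e.symm p))
  · obtain ⟨q, rfl⟩ := hφ.ge hp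
    exact ⟨e q, congrArg φ (e.symm_apply_apply q)⟩
  · exact (congrArg φ (e.symm_apply_apply _)).trans (hbr _ _)
  · rw [Nonembedding.mem_idealOfVars_iff]
    change coeff 0 (φ (e.symm (X s))) = 0
    rw [Nonembedding.translateEquiv_symm_X, map_sub, algHom_C, algebraMap_eq, coeff_sub,
      coeff_zero_C, sub_self]
end
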